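/- arXiv:1601.06264 — 2 statements merged into one kernel-verified Lean document; each statement's English description precedes it below -/
import Mathlib

section
/- Let Λ : ℝ[X₁,…,Xₙ] → ℝ be a positive definite linear functional. Then N(Λ) := {P ∈ ℝ[X₁,…,Xₙ] : Λ(P²) = 0} is a set ideal: there exists a subset Z of ℝⁿ such that N(Λ) = I(Z). -/
open MeasureTheory

noncomputable def evalR {n : ℕ} (P : MvPolynomial (Fin n) ℝ) (x : Fin n → ℝ) : ℝ :=
  MvPolynomial.eval x P

def IsPosDefR {n : ℕ} (Λ : MvPolynomial (Fin n) ℝ →ₗ[ℝ] ℝ) : Prop :=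
  ∀ P : MvPolynomial (Fin n) ℝ, 0 ≤ Λ (P ^ 2)

def IsMomentR {n : ℕ} (Λ : MvPolynomial (Fin n) ℝ →ₗ[ℝ] ℝ) : Prop :=
  ∃ μ : Measure (Fin n → ℝ),
    (∀ Q : MvPolynomial (Fin n) ℝ, Integrable (fun x => evalR Q x) μ) ∧
    (∀ Q : MvPolynomial (Fin n) ℝ, Λ Q = ∫ x, evalR Q x ∂μ)

noncomputable def vanishingIdealR {n : ℕ} (Z : Set (Fin n → ℝ)) :
    Ideal (MvPolynomial (Fin n) ℝ) where
  carrier := {P | ∀ x ∈ Z, evalR P x = 0}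
  add_mem' := by
    intro a b ha hb x hx
    simp only [Set.mem_setOf_eq, evalR, map_add] at *
    rw [ha x hx, hb x hx, add_zero]
  zero_mem' := by
    intro x hx
    simp [evalR]
  smul_mem' := by
    intro c a ha x hx
    simp only [Set.mem_setOf_eq, evalR, smul_eq_mul, map_mul] at *
    rw [ha x hx, mul_zero]

def zeroSetR {n : ℕ} (I : Ideal (MvPolynomial (Fin n) ℝ)) : Set (Fin n → ℝ) :=
  {x | ∀ P ∈ I, evalR P x = 0}

def zSetR {n : ℕ} (P : MvPolynomial (Fin n) ℝ) : Set (Fin n → ℝ) :=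
  {x | evalR P x = 0}

def VanishesOnR {n : ℕ} (Λ : MvPolynomial (Fin n) ℝ →ₗ[ℝ] ℝ)
    (I : Ideal (MvPolynomial (Fin n) ℝ)) : Prop :=
  ∀ P ∈ I, Λ P = 0

def nSetR {n : ℕ} (Λ : MvPolynomial (Fin n) ℝ →ₗ[ℝ] ℝ) : Set (MvPolynomial (Fin n) ℝ) :=
  {P | Λ (P ^ 2) = 0}

def IsTypeAR {n : ℕ} (P : MvPolynomial (Fin n) ℝ) : Prop :=
  ∀ Λ : MvPolynomial (Fin n) ℝ →ₗ[ℝ] ℝ,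
    IsPosDefR Λ → VanishesOnR Λ (Ideal.span {P}) → IsMomentR Λ

open Polynomial in
/-- The intermediate value property for polynomial functions on an ordered field. -/
def HasPolynomialIVT (R : Type*) [Field R] [LinearOrder R] : Prop :=
  ∀ (p : R[X]) (a b : R), a < b → p.eval a * p.eval b < 0 → ∃ c, a < c ∧ c < b ∧ p.eval c = 0

namespace HasPolynomialIVT

open Polynomial

variable {R : Type*} [Field R] [LinearOrder R] [IsStrictOrderedRing R]

theorem mul_pos_of_ne_zero (h : HasPolynomialIVT R) {p : R[X]} {a b : R} (hab : a ≤ b)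
    (hp : ∀ c, a ≤ c → c ≤ b → p.eval c ≠ 0) : 0 < p.eval a * p.eval b := by
  rcases hab.eq_or_lt with rfl | hlt
  · exact mul_self_pos.2 (hp a le_rfl le_rfl)
  · by_contra hn
    have hne : p.eval a * p.eval b ≠ 0 := mul_ne_zero (hp a le_rfl hab) (hp b hab le_rfl)
    obtain ⟨c, hac, hcb, hc⟩ := h p a b hlt (lt_of_le_of_ne (not_lt.1 hn) hne)
    exact hp c hac.le hcb.le hc

theorem sign_eq_of_ne_zero (h : HasPolynomialIVT R) {p : R[X]} {a b : R}
    (hp : ∀ c, min a b ≤ c → c ≤ max a b → p.eval c ≠ 0) :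
    SignType.sign (p.eval a) = SignType.sign (p.eval b) := by
  have key : 0 < p.eval a * p.eval b := by
    rcases le_total a b with hab | hab
    · exact h.mul_pos_of_ne_zero hab (by simpa [hab] using hp)
    · rw [mul_comm]
      exact h.mul_pos_of_ne_zero hab (by simpa [hab] using hp)
  rcases mul_pos_iff.1 key with ⟨h1, h2⟩ | ⟨h1, h2⟩
  · rw [sign_pos h1, sign_pos h2]
  · rw [sign_neg h1, sign_neg h2]

/-- Rolle's theorem for polynomials. -/
theorem exists_derivative_eq_zero (h : HasPolynomialIVT R) {p : R[X]} {a b : R} (hab : a < b)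
    (ha : p.eval a = 0) (hb : p.eval b = 0) :
    ∃ c, a < c ∧ c < b ∧ (derivative p).eval c = 0 := by
  classical
  by_cases hp : p = 0
  · subst hp
    obtain ⟨c, hac, hcb⟩ := exists_between hab
    exact ⟨c, hac, hcb, by simp⟩
  obtain ⟨d, hd, hmin⟩ := Finset.exists_min_image (p.roots.toFinset.filter (a < ·)) id
    ⟨b, by simp [hp, hab, hb]⟩
  simp only [Finset.mem_filter, Multiset.mem_toFinset, mem_roots hp, IsRoot.def, id] at hd hmin
  obtain ⟨hd0, had⟩ := hd
  obtain ⟨q, hq, hqa⟩ := exists_eq_pow_rootMultiplicity_mul_and_not_dvd p hp a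
  obtain ⟨m, hm⟩ : ∃ m, p.rootMultiplicity a = m + 1 :=
    Nat.exists_eq_succ_of_ne_zero ((rootMultiplicity_pos hp).2 ha).ne'
  rw [hm] at hq
  have hq0 : q ≠ 0 := by rintro rfl; simp at hqa
  obtain ⟨r, hr, hrd⟩ := exists_eq_pow_rootMultiplicity_mul_and_not_dvd q hq0 d
  have hqd : q.eval d = 0 := by
    rw [hq] at hd0
    simpa [sub_ne_zero.2 had.ne'] using hd0
  obtain ⟨k, hk⟩ : ∃ k, q.rootMultiplicity d = k + 1 :=
    Nat.exists_eq_succ_of_ne_zero ((rootMultiplicity_pos hq0).2 hqd).ne'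
  rw [hk] at hr
  rw [dvd_iff_isRoot, IsRoot.def] at hqa hrd
  have hpr : p = (X - C a) ^ (m + 1) * ((X - C d) ^ (k + 1) * r) := by rw [← hr, ← hq]
  have hrpos : 0 < r.eval a * r.eval d := by
    refine h.mul_pos_of_ne_zero had.le fun c hac hcd hc => ?_
    rcases hac.eq_or_lt with rfl | hac
    · exact hqa (by rw [hr]; simp [hc])
    · rcases hcd.eq_or_lt with rfl | hcd
      · exact hrd hc
      · exact absurd (hmin c ⟨by rw [hpr]; simp [hc], hac⟩) (not_le.2 hcd)
  set s : R[X] := C ((m : R) + 1) * (X - C d) * r + C ((k : R) + 1) * (X - C a) * r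
    + (X - C a) * (X - C d) * derivative r with hs
  have hder : derivative p = (X - C a) ^ m * (X - C d) ^ k * s := by
    rw [hpr, hs]
    simp only [derivative_mul, derivative_X_sub_C_pow, Nat.add_sub_cancel]
    push_cast
    simp only [map_add, map_natCast, map_one]
    ring
  have hm0 : (0 : R) < (m : R) + 1 := by positivity
  have hk0 : (0 : R) < (k : R) + 1 := by positivity
  obtain ⟨c, hac, hcd, hc⟩ := h s a d had (by
    have h1 : s.eval a * s.eval d
        = -(((m : R) + 1) * ((k : R) + 1) * (d - a) ^ 2 * (r.eval a * r.eval d)) := by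
      simp [hs]; ring
    rw [h1, neg_lt_zero]
    have : 0 < d - a := sub_pos.2 had
    positivity)
  exact ⟨c, hac, hcd.trans_le (hmin b ⟨hb, hab⟩), by rw [hder]; simp [hc]⟩

/-- A polynomial changes sign at a root around which its derivative does not vanish. -/
theorem mul_neg_of_derivative_ne_zero (h : HasPolynomialIVT R) {p : R[X]} {a b c : R}
    (hac : a < c) (hcb : c < b) (hc : p.eval c = 0)
    (hp : ∀ x, a < x → x < b → (derivative p).eval x ≠ 0) : p.eval a * p.eval b < 0 := by
  obtain ⟨q, rfl⟩ := dvd_iff_isRoot.2 hc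
  have hq : 0 < q.eval a * q.eval b := by
    refine h.mul_pos_of_ne_zero (hac.trans hcb).le fun x hax hxb hx => ?_
    have hx0 : ((X - C c) * q).eval x = 0 := by simp [hx]
    rcases lt_trichotomy x c with hxc | rfl | hxc
    · obtain ⟨y, h1, h2, h3⟩ := h.exists_derivative_eq_zero hxc hx0 hc
      exact hp y (hax.trans_lt h1) (h2.trans hcb) h3
    · exact hp x hac hcb (by simp [derivative_mul, hx])
    · obtain ⟨y, h1, h2, h3⟩ := h.exists_derivative_eq_zero hxc hc hx0
      exact hp y (hac.trans h1) (h2.trans_le hxb) h3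
  have h1 : ((X - C c) * q).eval a * ((X - C c) * q).eval b
      = -((c - a) * (b - c) * (q.eval a * q.eval b)) := by simp; ring
  rw [h1, neg_lt_zero]
  exact mul_pos (mul_pos (sub_pos.2 hac) (sub_pos.2 hcb)) hq

end HasPolynomialIVT

open Polynomial in
/-- A Cauchy-type bound for the roots of a monic polynomial over an ordered field. -/
theorem Polynomial.Monic.abs_lt_of_eval_eq_zero {R : Type*} [Field R] [LinearOrder R]
    [IsStrictOrderedRing R] {p : R[X]} (hp : p.Monic) {a : R} (ha : p.eval a = 0) :
    |a| < 1 + ∑ i ∈ Finset.range p.natDegree, (p.coeff i ^ 2 + 1) := by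
  by_contra hlt
  rw [not_lt] at hlt
  set M := ∑ i ∈ Finset.range p.natDegree, (p.coeff i ^ 2 + 1) with hM
  have hM0 : 0 ≤ M := Finset.sum_nonneg fun i _ => by positivity
  have h1 : 1 ≤ |a| := by linarith
  obtain ⟨n, hn⟩ : ∃ n, p.natDegree = n + 1 := by
    refine Nat.exists_eq_succ_of_ne_zero fun h0 => ?_
    rw [hp.natDegree_eq_zero.1 h0] at ha
    simp at ha
  have hsum : a ^ (n + 1) = -∑ i ∈ Finset.range p.natDegree, p.coeff i * a ^ i := by
    rw [eval_eq_sum_range, Finset.sum_range_succ, hp.coeff_natDegree, one_mul] at ha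
    rw [← hn]
    linear_combination ha
  have hle : |a| ^ (n + 1) ≤ M * |a| ^ n := by
    rw [← abs_pow, hsum, abs_neg, hM, Finset.sum_mul]
    refine (Finset.abs_sum_le_sum_abs _ _).trans (Finset.sum_le_sum fun i hi => ?_)
    rw [abs_mul, abs_pow]
    have hi' : i ≤ n := by rw [hn, Finset.mem_range] at hi; omega
    have hc : |p.coeff i| ≤ p.coeff i ^ 2 + 1 := by
      rw [← sq_abs]; nlinarith [sq_nonneg (|p.coeff i| - 1), abs_nonneg (p.coeff i)]
    exact mul_le_mul hc (pow_le_pow_right₀ h1 hi') (by positivity) (by positivity)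
  have hpos : 0 < |a| ^ n := by positivity
  rw [pow_succ'] at hle
  have := le_of_mul_le_mul_right hle hpos
  linarith

/-- A subring of `R × S` is sign-matching if it is the graph of an order isomorphism between
subrings of `R` and `S`. -/
def SignMatching {R S : Type*} [Field R] [LinearOrder R] [Field S] [LinearOrder S]
    (Γ : Subring (R × S)) : Prop :=
  ∀ x ∈ Γ, SignType.sign x.1 = SignType.sign x.2

namespace SignMatching

open Polynomial

section

variable {R S : Type*} [Field R] [Field S]

/-- The first projection of a subring of a product. -/
def fstHom (Γ : Subring (R × S)) : Γ →+* R := (RingHom.fst R S).comp Γ.subtype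

/-- The second projection of a subring of a product. -/
def sndHom (Γ : Subring (R × S)) : Γ →+* S := (RingHom.snd R S).comp Γ.subtype

theorem eval₂_mem {Γ Γ' : Subring (R × S)} (hle : Γ ≤ Γ') {a : R} {b : S} (hab : (a, b) ∈ Γ')
    (p : Γ[X]) : (p.eval₂ (fstHom Γ) a, p.eval₂ (sndHom Γ) b) ∈ Γ' := by
  have h1 : (p.eval₂ (fstHom Γ) a, p.eval₂ (sndHom Γ) b) = p.eval₂ Γ.subtype (a, b) :=
    Prod.ext (hom_eval₂ p Γ.subtype (RingHom.fst R S) (a, b)).symm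
      (hom_eval₂ p Γ.subtype (RingHom.snd R S) (a, b)).symm
  rw [h1, eval₂_eq_sum_range]
  exact sum_mem fun i _ => mul_mem (hle (p.coeff i).2) (pow_mem hab i)

theorem eval₂_inclusion_fst {Γ Γ' : Subring (R × S)} (hle : Γ ≤ Γ') (p : Γ[X]) (a : R) :
    (p.map (Subring.inclusion hle)).eval₂ (fstHom Γ') a = p.eval₂ (fstHom Γ) a := by
  rw [eval₂_map]; rfl

theorem map_inclusion_ne_zero {Γ Γ' : Subring (R × S)} (hle : Γ ≤ Γ') {p : Γ[X]} (hp : p ≠ 0) :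
    p.map (Subring.inclusion hle) ≠ 0 :=
  (Polynomial.map_ne_zero_iff (Subring.inclusion_injective hle)).2 hp

end

variable {R S : Type*} [Field R] [LinearOrder R] [Field S] [LinearOrder S]

theorem fst_eq_zero_iff {Γ : Subring (R × S)} (hΓ : SignMatching Γ) {x : R × S} (hx : x ∈ Γ) :
    x.1 = 0 ↔ x.2 = 0 := by
  rw [← sign_eq_zero_iff, hΓ x hx, sign_eq_zero_iff]

theorem fstHom_injective {Γ : Subring (R × S)} (hΓ : SignMatching Γ) :
    Function.Injective (fstHom Γ) := by
  rw [injective_iff_map_eq_zero]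
  intro x hx
  exact Subtype.ext (Prod.ext hx ((hΓ.fst_eq_zero_iff x.2).1 hx))

theorem sndHom_injective {Γ : Subring (R × S)} (hΓ : SignMatching Γ) :
    Function.Injective (sndHom Γ) := by
  rw [injective_iff_map_eq_zero]
  intro x hx
  exact Subtype.ext (Prod.ext ((hΓ.fst_eq_zero_iff x.2).2 hx) hx)

theorem exists_mem_of_sign_eval₂ {Γ : Subring (R × S)} {a : R} {b : S}
    (h : ∀ p : Γ[X], SignType.sign (p.eval₂ (fstHom Γ) a) = SignType.sign (p.eval₂ (sndHom Γ) b)) :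
    ∃ Γ' : Subring (R × S), Γ ≤ Γ' ∧ SignMatching Γ' ∧ (a, b) ∈ Γ' := by
  refine ⟨(eval₂RingHom Γ.subtype (a, b)).range, fun x hx => ⟨C ⟨x, hx⟩, by simp⟩, ?_, X, by simp⟩
  rintro _ ⟨p, rfl⟩
  have h1 := hom_eval₂ p Γ.subtype (RingHom.fst R S) (a, b)
  have h2 := hom_eval₂ p Γ.subtype (RingHom.snd R S) (a, b)
  simp only [coe_eval₂RingHom]
  rw [RingHom.coe_fst] at h1
  rw [RingHom.coe_snd] at h2
  rw [h1, h2]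
  exact h p

variable [IsStrictOrderedRing R] [IsStrictOrderedRing S]

theorem fst_lt_iff {Γ : Subring (R × S)} (hΓ : SignMatching Γ) {x y : R × S} (hx : x ∈ Γ)
    (hy : y ∈ Γ) : x.1 < y.1 ↔ x.2 < y.2 := by
  rw [← sub_pos, ← sign_eq_one_iff, ← Prod.fst_sub, hΓ _ (sub_mem hy hx), Prod.snd_sub,
    sign_eq_one_iff, sub_pos]

/-- The closure of a sign-matching subring under inverses. -/
theorem exists_inv_mem {Γ : Subring (R × S)} (hΓ : SignMatching Γ) :
    ∃ Γ' : Subring (R × S), Γ ≤ Γ' ∧ SignMatching Γ' ∧ ∀ x ∈ Γ', x⁻¹ ∈ Γ' := by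
  have h2 : ∀ {y : R × S}, y ∈ Γ → y.1 ≠ 0 → y.2 ≠ 0 :=
    fun hy h => fun h' => h ((hΓ.fst_eq_zero_iff hy).2 h')
  refine ⟨{ carrier := {z | ∃ x ∈ Γ, ∃ y ∈ Γ, y.1 ≠ 0 ∧ z = x * y⁻¹}
            mul_mem' := ?_, one_mem' := ?_, add_mem' := ?_, zero_mem' := ?_, neg_mem' := ?_ },
          ?_, ?_, ?_⟩
  · rintro _ _ ⟨x, hx, y, hy, h, rfl⟩ ⟨x', hx', y', hy', h', rfl⟩
    refine ⟨x * x', mul_mem hx hx', y * y', mul_mem hy hy', mul_ne_zero h h', ?_⟩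
    have := h2 hy h
    have := h2 hy' h'
    ext <;> simp <;> field_simp
  · exact ⟨1, one_mem _, 1, one_mem _, by simp, by ext <;> simp⟩
  · rintro _ _ ⟨x, hx, y, hy, h, rfl⟩ ⟨x', hx', y', hy', h', rfl⟩
    refine ⟨x * y' + x' * y, add_mem (mul_mem hx hy') (mul_mem hx' hy), y * y', mul_mem hy hy',
      mul_ne_zero h h', ?_⟩
    have := h2 hy h
    have := h2 hy' h'
    ext <;> simp <;> field_simp
  · exact ⟨0, zero_mem _, 1, one_mem _, by simp, by ext <;> simp⟩
  · rintro _ ⟨x, hx, y, hy, h, rfl⟩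
    exact ⟨-x, neg_mem hx, y, hy, h, by ext <;> simp⟩
  · exact fun x hx => ⟨x, hx, 1, one_mem _, by simp, by ext <;> simp⟩
  · rintro _ ⟨x, hx, y, hy, h, rfl⟩
    have hy2 := h2 hy h
    have e1 : SignType.sign ((x * y⁻¹).1) = SignType.sign (x * y).1 := by
      have : (x * y⁻¹).1 = (x * y).1 * (y.1⁻¹ * y.1⁻¹) := by simp; field_simp
      rw [this, sign_mul, sign_pos (mul_self_pos.2 (inv_ne_zero h)), mul_one]
    have e2 : SignType.sign ((x * y⁻¹).2) = SignType.sign (x * y).2 := by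
      have : (x * y⁻¹).2 = (x * y).2 * (y.2⁻¹ * y.2⁻¹) := by simp; field_simp
      rw [this, sign_mul, sign_pos (mul_self_pos.2 (inv_ne_zero hy2)), mul_one]
    rw [e1, e2, hΓ _ (mul_mem hx hy)]
  · rintro _ ⟨x, hx, y, hy, h, rfl⟩
    by_cases hx0 : x.1 = 0
    · have hx2 := (hΓ.fst_eq_zero_iff hx).1 hx0
      exact ⟨0, zero_mem _, 1, one_mem _, by simp, by ext <;> simp [hx0, hx2]⟩
    · exact ⟨y, hy, x, hx, hx0, by ext <;> simp⟩

end SignMatching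

/-- Every sign-matching subring of `R × S` extends along each element of `R` that is algebraic of
degree less than `n` over it. -/
def SignMatchingExtends (R S : Type*) [Field R] [LinearOrder R] [Field S] [LinearOrder S]
    (n : ℕ) : Prop :=
  ∀ (Γ : Subring (R × S)), SignMatching Γ → ∀ p : Polynomial Γ, p ≠ 0 → p.natDegree < n →
    ∀ a : R, p.eval₂ (SignMatching.fstHom Γ) a = 0 →
      ∃ Γ' : Subring (R × S), Γ ≤ Γ' ∧ SignMatching Γ' ∧ ∃ b, (a, b) ∈ Γ'

namespace SignMatchingExtends

open Polynomial SignMatching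

variable {R S : Type*} [Field R] [LinearOrder R] [Field S] [LinearOrder S]

theorem extend_snd {n : ℕ} (h : SignMatchingExtends S R n) {Γ : Subring (R × S)}
    (hΓ : SignMatching Γ) {p : Γ[X]} (hp : p ≠ 0) (hn : p.natDegree < n) {b : S}
    (hb : p.eval₂ (sndHom Γ) b = 0) :
    ∃ Γ' : Subring (R × S), Γ ≤ Γ' ∧ SignMatching Γ' ∧ ∃ a, (a, b) ∈ Γ' := by
  let e : S × R →+* R × S := (RingEquiv.prodComm : S × R ≃+* R × S).toRingHom
  let e' : R × S →+* S × R := (RingEquiv.prodComm : R × S ≃+* S × R).toRingHom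
  let i : Γ →+* Γ.comap e := (e'.comp Γ.subtype).codRestrict _ fun x => x.2
  have hi : Function.Injective i := fun x y hxy => by
    have h1 : e' x = e' y := congrArg Subtype.val hxy
    exact Subtype.ext ((RingEquiv.prodComm : R × S ≃+* S × R).injective h1)
  obtain ⟨Γ', hle, hΓ', a, ha⟩ := h (Γ.comap e) (fun x hx => (hΓ _ hx).symm) (p.map i)
    ((Polynomial.map_ne_zero_iff hi).2 hp) (natDegree_map_le.trans_lt hn) b (by
      rw [eval₂_map]; exact hb)
  exact ⟨Γ'.comap e', fun x hx => hle (show e (e' x) ∈ Γ from hx),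
    fun x hx => (hΓ' _ hx).symm, a, ha⟩

theorem extend_finset {n : ℕ} (h : SignMatchingExtends R S n) {Γ : Subring (R × S)}
    (hΓ : SignMatching Γ) (T : Finset R)
    (hT : ∀ a ∈ T, ∃ p : Γ[X], p ≠ 0 ∧ p.natDegree < n ∧ p.eval₂ (fstHom Γ) a = 0) :
    ∃ Γ' : Subring (R × S), Γ ≤ Γ' ∧ SignMatching Γ' ∧ ∀ a ∈ T, ∃ b, (a, b) ∈ Γ' := by
  classical
  induction T using Finset.induction_on with
  | empty => exact ⟨Γ, le_rfl, hΓ, by simp⟩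
  | insert a T _ ih =>
    obtain ⟨Γ₁, hle₁, hΓ₁, h₁⟩ := ih fun c hc => hT c (Finset.mem_insert_of_mem hc)
    obtain ⟨p, hp, hn, ha⟩ := hT a (Finset.mem_insert_self _ _)
    obtain ⟨Γ₂, hle₂, hΓ₂, b, hb⟩ := h Γ₁ hΓ₁ (p.map (Subring.inclusion hle₁))
      (map_inclusion_ne_zero hle₁ hp) (natDegree_map_le.trans_lt hn) a
      (by rw [eval₂_inclusion_fst, ha])
    refine ⟨Γ₂, hle₁.trans hle₂, hΓ₂, fun c hc => ?_⟩
    rcases Finset.mem_insert.1 hc with rfl | hc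
    · exact ⟨b, hb⟩
    · obtain ⟨d, hd⟩ := h₁ c hc
      exact ⟨d, hle₂ hd⟩

theorem extend_finset_snd {n : ℕ} (h : SignMatchingExtends S R n) {Γ : Subring (R × S)}
    (hΓ : SignMatching Γ) (T : Finset S)
    (hT : ∀ b ∈ T, ∃ p : Γ[X], p ≠ 0 ∧ p.natDegree < n ∧ p.eval₂ (sndHom Γ) b = 0) :
    ∃ Γ' : Subring (R × S), Γ ≤ Γ' ∧ SignMatching Γ' ∧ ∀ b ∈ T, ∃ a, (a, b) ∈ Γ' := by
  classical
  induction T using Finset.induction_on with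
  | empty => exact ⟨Γ, le_rfl, hΓ, by simp⟩
  | insert a T _ ih =>
    obtain ⟨Γ₁, hle₁, hΓ₁, h₁⟩ := ih fun c hc => hT c (Finset.mem_insert_of_mem hc)
    obtain ⟨p, hp, hn, ha⟩ := hT a (Finset.mem_insert_self _ _)
    obtain ⟨Γ₂, hle₂, hΓ₂, b, hb⟩ := h.extend_snd hΓ₁ (p := p.map (Subring.inclusion hle₁))
      (map_inclusion_ne_zero hle₁ hp) (natDegree_map_le.trans_lt hn) (b := a)
      (by rw [eval₂_map]; exact ha)
    refine ⟨Γ₂, hle₁.trans hle₂, hΓ₂, fun c hc => ?_⟩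
    rcases Finset.mem_insert.1 hc with rfl | hc
    · exact ⟨b, hb⟩
    · obtain ⟨d, hd⟩ := h₁ c hc
      exact ⟨d, hle₂ hd⟩

theorem extend_roots {n : ℕ} (h : SignMatchingExtends R S n) {Γ : Subring (R × S)}
    (hΓ : SignMatching Γ) (G : Finset Γ[X]) (hG : ∀ g ∈ G, g ≠ 0 ∧ g.natDegree < n) :
    ∃ Γ' : Subring (R × S), Γ ≤ Γ' ∧ SignMatching Γ' ∧
      ∀ g ∈ G, ∀ a, g.eval₂ (fstHom Γ) a = 0 → ∃ b, (a, b) ∈ Γ' := by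
  classical
  obtain ⟨Γ', hle, hΓ', h'⟩ := h.extend_finset hΓ
    (G.biUnion fun g => (g.map (fstHom Γ)).roots.toFinset) (by
      intro a ha
      simp only [Finset.mem_biUnion, Multiset.mem_toFinset] at ha
      obtain ⟨g, hg, ha⟩ := ha
      exact ⟨g, (hG g hg).1, (hG g hg).2, by rw [← eval_map]; exact (mem_roots'.1 ha).2⟩)
  refine ⟨Γ', hle, hΓ', fun g hg a ha => h' a ?_⟩
  simp only [Finset.mem_biUnion, Multiset.mem_toFinset]
  refine ⟨g, hg, mem_roots'.2 ⟨(Polynomial.map_ne_zero_iff hΓ.fstHom_injective).2 (hG g hg).1, ?_⟩⟩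
  rw [IsRoot.def, eval_map, ha]

theorem extend_roots_snd {n : ℕ} (h : SignMatchingExtends S R n) {Γ Γ₁ : Subring (R × S)}
    (hΓ : SignMatching Γ) (hle₁ : Γ ≤ Γ₁) (hΓ₁ : SignMatching Γ₁) (G : Finset Γ[X])
    (hG : ∀ g ∈ G, g ≠ 0 ∧ g.natDegree < n) :
    ∃ Γ' : Subring (R × S), Γ₁ ≤ Γ' ∧ SignMatching Γ' ∧
      ∀ g ∈ G, ∀ b, g.eval₂ (sndHom Γ) b = 0 → ∃ a, (a, b) ∈ Γ' := by
  classical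
  obtain ⟨Γ', hle, hΓ', h'⟩ := h.extend_finset_snd hΓ₁
    (G.biUnion fun g => (g.map (sndHom Γ)).roots.toFinset) (by
      intro a ha
      simp only [Finset.mem_biUnion, Multiset.mem_toFinset] at ha
      obtain ⟨g, hg, ha⟩ := ha
      refine ⟨g.map (Subring.inclusion hle₁), map_inclusion_ne_zero hle₁ (hG g hg).1,
        natDegree_map_le.trans_lt (hG g hg).2, ?_⟩
      rw [eval₂_map]
      have := (mem_roots'.1 ha).2
      rwa [IsRoot.def, eval_map] at this)
  refine ⟨Γ', hle, hΓ', fun g hg a ha => h' a ?_⟩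
  simp only [Finset.mem_biUnion, Multiset.mem_toFinset]
  refine ⟨g, hg, mem_roots'.2 ⟨(Polynomial.map_ne_zero_iff hΓ.sndHom_injective).2 (hG g hg).1, ?_⟩⟩
  rw [IsRoot.def, eval_map, ha]

end SignMatchingExtends

/-- Around a point outside a finite set there is an interval which avoids the set and has its lower
end in the set or at a given point. -/
theorem Finset.exists_lower_neighbor {R : Type*} [LinearOrder R] (T : Finset R) {a l : R}
    (hl : l < a) : ∃ z, (z = l ∨ z ∈ T) ∧ z < a ∧ ∀ t ∈ T, t < a → t ≤ z := by
  classical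
  obtain ⟨z, hz, hmax⟩ := Finset.exists_max_image ((insert l T).filter (· < a)) id ⟨l, by simp [hl]⟩
  simp only [Finset.mem_filter, Finset.mem_insert, id] at hz hmax
  exact ⟨z, hz.1, hz.2, fun t ht hta => hmax t ⟨Or.inr ht, hta⟩⟩

theorem Finset.exists_upper_neighbor {R : Type*} [LinearOrder R] (T : Finset R) {a l : R}
    (hl : a < l) : ∃ z, (z = l ∨ z ∈ T) ∧ a < z ∧ ∀ t ∈ T, a < t → z ≤ t :=
  Finset.exists_lower_neighbor (R := Rᵒᵈ) T hl

namespace SignMatching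

open Polynomial

theorem exists_abs_lt {R S : Type*} [Field R] [LinearOrder R] [IsStrictOrderedRing R] [Field S]
    {Γ : Subring (R × S)} {p : Γ[X]} (hp : p.Monic) {a : R}
    (ha : p.eval₂ (fstHom Γ) a = 0) : ∃ m ∈ Γ, |a| < m.1 := by
  have h := (hp.map (fstHom Γ)).abs_lt_of_eval_eq_zero (a := a) (by rw [eval_map, ha])
  let s : Γ := 1 + ∑ i ∈ Finset.range (p.map (fstHom Γ)).natDegree, (p.coeff i ^ 2 + 1)
  refine ⟨s, s.2, h.trans_eq ?_⟩
  change _ = fstHom Γ s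
  simp only [s, map_add, map_sum, map_pow, map_one, coeff_map]

theorem exists_monic {R S : Type*} [Field R] [LinearOrder R] [Field S] [LinearOrder S]
    {Γ : Subring (R × S)} (hΓ : SignMatching Γ) (hinv : ∀ x ∈ Γ, x⁻¹ ∈ Γ)
    {p : Γ[X]} (hp : p ≠ 0) {a : R} (ha : p.eval₂ (fstHom Γ) a = 0) :
    ∃ f : Γ[X], f.Monic ∧ f.natDegree ≤ p.natDegree ∧ f.eval₂ (fstHom Γ) a = 0 := by
  set c := p.leadingCoeff with hc
  have hc1 : (c : R × S).1 ≠ 0 := fun h =>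
    leadingCoeff_ne_zero.2 hp (hΓ.fstHom_injective (h.trans (map_zero (fstHom Γ)).symm))
  have hc2 : (c : R × S).2 ≠ 0 := fun h => hc1 ((hΓ.fst_eq_zero_iff c.2).2 h)
  let d : Γ := ⟨(c : R × S)⁻¹, hinv _ c.2⟩
  have hdc : d * c = 1 := Subtype.ext (Prod.ext (inv_mul_cancel₀ hc1) (inv_mul_cancel₀ hc2))
  exact ⟨C d * p, monic_C_mul_of_mul_leadingCoeff_eq_one hdc, natDegree_C_mul_le _ _,
    by rw [eval₂_mul, ha, mul_zero]⟩

end SignMatching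

namespace SignMatchingExtends

open Polynomial SignMatching

variable {R S : Type*} [Field R] [LinearOrder R] [IsStrictOrderedRing R]
  [Field S] [LinearOrder S] [IsStrictOrderedRing S]

/-- The case of an element of degree exactly `n` whose minimal polynomial is `f`. -/
theorem extend_of_minimal (hR : HasPolynomialIVT R) (hS : HasPolynomialIVT S) {n : ℕ}
    (h : SignMatchingExtends R S n) (h' : SignMatchingExtends S R n) {Γ : Subring (R × S)}
    (hΓ : SignMatching Γ) {f : Γ[X]} (hf : f.Monic) (hfn : f.natDegree = n) {a : R}
    (ha : f.eval₂ (fstHom Γ) a = 0)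
    (hmin : ∀ p : Γ[X], p ≠ 0 → p.natDegree < n → p.eval₂ (fstHom Γ) a ≠ 0) :
    ∃ Γ' : Subring (R × S), Γ ≤ Γ' ∧ SignMatching Γ' ∧ ∃ b, (a, b) ∈ Γ' := by
  classical
  by_contra hcon
  push Not at hcon
  have hf1 : f ≠ 1 := by rintro rfl; simp at ha
  have hn0 : f.natDegree ≠ 0 := fun h0 => hf1 (hf.natDegree_eq_zero.1 h0)
  have hsep : ∀ b : S, f.eval₂ (sndHom Γ) b = 0 → ∃ r : Γ[X], r.natDegree < n ∧
      SignType.sign (r.eval₂ (fstHom Γ) a) ≠ SignType.sign (r.eval₂ (sndHom Γ) b) := by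
    intro b hb
    by_contra! hb'
    obtain ⟨Γ', hle, hΓ', hab⟩ := exists_mem_of_sign_eval₂ (Γ := Γ) (a := a) (b := b) fun p => by
      have hp := hb' (p %ₘ f) (hfn ▸ natDegree_modByMonic_lt p hf hf1)
      rw [← modByMonic_add_div p f]
      simpa [eval₂_add, eval₂_mul, ha, hb] using hp
    exact hcon Γ' hle hΓ' b hab
  choose! r hrn hr using hsep
  have hfS : f.map (sndHom Γ) ≠ 0 := (hf.map _).ne_zero
  have hfder : derivative f ≠ 0 := fun h0 => by
    have h1 : derivative (f.map (fstHom Γ)) = 0 := by rw [derivative_map, h0, Polynomial.map_zero]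
    have h2 := derivative_eq_zero.1 h1
    rw [hf.natDegree_map] at h2
    exact hn0 h2
  let G : Finset Γ[X] := insert (derivative f) ((f.map (sndHom Γ)).roots.toFinset.image r)
  have hrG : ∀ b, f.eval₂ (sndHom Γ) b = 0 → r b ∈ G := fun b hb =>
    Finset.mem_insert_of_mem (Finset.mem_image_of_mem r (by
      rw [Multiset.mem_toFinset, mem_roots hfS, IsRoot.def, eval_map, hb]))
  have hG : ∀ g ∈ G, g ≠ 0 ∧ g.natDegree < n := by
    intro g hg
    rcases Finset.mem_insert.1 hg with rfl | hg
    · exact ⟨hfder, hfn ▸ natDegree_derivative_lt hn0⟩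
    · obtain ⟨b, hb, rfl⟩ := Finset.mem_image.1 hg
      rw [Multiset.mem_toFinset, mem_roots hfS, IsRoot.def, eval_map] at hb
      refine ⟨fun h0 => hr b hb ?_, hrn b hb⟩
      simp [h0]
  obtain ⟨Γ₁, hle₁, hΓ₁, h₁⟩ := h.extend_roots hΓ G hG
  obtain ⟨Γ₂, hle₂, hΓ₂, h₂⟩ := h'.extend_roots_snd hΓ hle₁ hΓ₁ G hG
  obtain ⟨Δ, hle₃, hΔ, hinv⟩ := hΓ₂.exists_inv_mem
  have hΓΔ : Γ ≤ Δ := hle₁.trans (hle₂.trans hle₃)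
  let T : Finset R := G.biUnion fun g => (g.map (fstHom Γ)).roots.toFinset
  have hT : ∀ t, t ∈ T ↔ ∃ g ∈ G, g.eval₂ (fstHom Γ) t = 0 := by
    intro t
    simp only [T, Finset.mem_biUnion, Multiset.mem_toFinset]
    refine exists_congr fun g => and_congr_right fun hg => ?_
    rw [mem_roots ((Polynomial.map_ne_zero_iff hΓ.fstHom_injective).2 (hG g hg).1), IsRoot.def,
      eval_map]
  have haT : a ∉ T := fun haT => by
    obtain ⟨g, hg, hga⟩ := (hT a).1 haT
    exact hmin g (hG g hg).1 (hG g hg).2 hga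
  have hTΔ : ∀ t ∈ T, ∃ s, (t, s) ∈ Δ := fun t ht => by
    obtain ⟨g, hg, hgt⟩ := (hT t).1 ht
    obtain ⟨s, hs⟩ := h₁ g hg t hgt
    exact ⟨s, hle₃ (hle₂ hs)⟩
  obtain ⟨m, hm, ham⟩ := exists_abs_lt hf ha
  obtain ⟨x₁, hx₁, hxa, hxT⟩ := T.exists_lower_neighbor (neg_lt_of_abs_lt ham)
  obtain ⟨y₁, hy₁, hay, hyT⟩ := T.exists_upper_neighbor (lt_of_abs_lt ham)
  obtain ⟨x₂, hx⟩ : ∃ x₂, (x₁, x₂) ∈ Δ := by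
    rcases hx₁ with rfl | hx₁
    · exact ⟨-m.2, hΓΔ (neg_mem hm)⟩
    · exact hTΔ _ hx₁
  obtain ⟨y₂, hy⟩ : ∃ y₂, (y₁, y₂) ∈ Δ := by
    rcases hy₁ with rfl | hy₁
    · exact ⟨m.2, hΓΔ hm⟩
    · exact hTΔ _ hy₁
  have hGR : ∀ g ∈ G, ∀ t, x₁ < t → t < y₁ → (g.map (fstHom Γ)).eval t ≠ 0 := by
    intro g hg t hxt hty hgt
    rw [eval_map] at hgt
    have htT := (hT t).2 ⟨g, hg, hgt⟩
    rcases lt_trichotomy t a with hta | rfl | hta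
    · exact absurd (hxT t htT hta) (not_le.2 hxt)
    · exact haT htT
    · exact absurd (hyT t htT hta) (not_le.2 hty)
  have hGS : ∀ g ∈ G, ∀ t, x₂ < t → t < y₂ → (g.map (sndHom Γ)).eval t ≠ 0 := by
    intro g hg t hxt hty hgt
    rw [eval_map] at hgt
    obtain ⟨c, hc⟩ := h₂ g hg t hgt
    have hcΔ : (c, t) ∈ Δ := hle₃ hc
    refine hGR g hg c ((hΔ.fst_lt_iff hx hcΔ).2 hxt) ((hΔ.fst_lt_iff hcΔ hy).2 hty) ?_
    rw [eval_map]
    exact (hΔ.fst_eq_zero_iff (eval₂_mem hΓΔ hcΔ g)).2 hgt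
  have hsign : (f.map (fstHom Γ)).eval x₁ * (f.map (fstHom Γ)).eval y₁ < 0 :=
    hR.mul_neg_of_derivative_ne_zero hxa hay (by rw [eval_map, ha]) fun t hxt hty => by
      rw [derivative_map]
      exact hGR _ (Finset.mem_insert_self _ _) t hxt hty
  have hsign' : (f.map (sndHom Γ)).eval x₂ * (f.map (sndHom Γ)).eval y₂ < 0 := by
    have hmem := mul_mem (eval₂_mem hΓΔ hx f) (eval₂_mem hΓΔ hy f)
    rw [eval_map, eval_map, ← sign_eq_neg_one_iff] at hsign ⊢
    rw [← hsign]
    exact (hΔ _ hmem).symm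
  have hxy : x₂ < y₂ := (hΔ.fst_lt_iff hx hy).1 (hxa.trans hay)
  obtain ⟨b, hxb, hby, hb⟩ := hS _ _ _ hxy hsign'
  rw [eval_map] at hb
  have hmid : ((x₁ + y₁) / 2, (x₂ + y₂) / 2) ∈ Δ := by
    have h2 : ((2 : R)⁻¹, (2 : S)⁻¹) ∈ Δ := hinv (2, 2) (natCast_mem Δ 2)
    rw [div_eq_mul_inv, div_eq_mul_inv]
    exact mul_mem (add_mem hx hy) h2
  have hxy₁ : x₁ < y₁ := hxa.trans hay
  refine hr b hb ?_
  have e₁ := hR.sign_eq_of_ne_zero (p := (r b).map (fstHom Γ)) (a := a) (b := (x₁ + y₁) / 2)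
    fun c hc hc' => hGR _ (hrG b hb) c (lt_of_lt_of_le (lt_min hxa (by linarith)) hc)
      (lt_of_le_of_lt hc' (max_lt hay (by linarith)))
  have e₂ := hS.sign_eq_of_ne_zero (p := (r b).map (sndHom Γ)) (a := b) (b := (x₂ + y₂) / 2)
    fun c hc hc' => hGS _ (hrG b hb) c (lt_of_lt_of_le (lt_min hxb (by linarith)) hc)
      (lt_of_le_of_lt hc' (max_lt hby (by linarith)))
  rw [eval_map, eval_map] at e₁ e₂
  rw [e₁, e₂]
  exact hΔ _ (eval₂_mem hΓΔ hmid (r b))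

theorem succ (hR : HasPolynomialIVT R) (hS : HasPolynomialIVT S) {n : ℕ}
    (h : SignMatchingExtends R S n) (h' : SignMatchingExtends S R n) :
    SignMatchingExtends R S (n + 1) := by
  intro Γ hΓ p hp hpn a ha
  obtain ⟨Γ₁, hle, hΓ₁, hinv⟩ := hΓ.exists_inv_mem
  suffices ∃ Γ' : Subring (R × S), Γ₁ ≤ Γ' ∧ SignMatching Γ' ∧ ∃ b, (a, b) ∈ Γ' by
    obtain ⟨Γ', hle', hΓ', hb⟩ := this
    exact ⟨Γ', hle.trans hle', hΓ', hb⟩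
  by_cases hmin : ∀ q : Γ₁[X], q ≠ 0 → q.natDegree < n → q.eval₂ (fstHom Γ₁) a ≠ 0
  · obtain ⟨f, hf, hfp, hfa⟩ := exists_monic hΓ₁ hinv (map_inclusion_ne_zero hle hp)
      (a := a) (by rw [eval₂_inclusion_fst, ha])
    have hfn : f.natDegree ≤ n := hfp.trans (natDegree_map_le.trans (Nat.lt_succ_iff.1 hpn))
    refine extend_of_minimal hR hS h h' hΓ₁ hf (le_antisymm hfn (not_lt.1 fun hlt => ?_)) hfa hmin
    exact hmin f hf.ne_zero hlt hfa
  · push Not at hmin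
    obtain ⟨q, hq, hqn, hqa⟩ := hmin
    exact h Γ₁ hΓ₁ q hq hqn a hqa

theorem of_hasPolynomialIVT (hR : HasPolynomialIVT R) (hS : HasPolynomialIVT S) (n : ℕ) :
    SignMatchingExtends R S n ∧ SignMatchingExtends S R n := by
  induction n with
  | zero => exact ⟨fun _ _ _ _ h => absurd h (Nat.not_lt_zero _),
      fun _ _ _ _ h => absurd h (Nat.not_lt_zero _)⟩
  | succ n ih => exact ⟨ih.1.succ hR hS ih.2, ih.2.succ hS hR ih.1⟩

end SignMatchingExtends

/-- The rational points over a finite set `T` meet every component of the complement of `T`. -/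
theorem Finset.exists_same_side {R : Type*} [Field R] [LinearOrder R] [IsStrictOrderedRing R]
    (T : Finset R) (Q : R → Prop) (hQT : ∀ t ∈ T, Q t) (hQ0 : Q 0)
    (hQsub : ∀ t, Q t → Q (t - 1)) (hQadd : ∀ t, Q t → Q (t + 1))
    (hQmid : ∀ s t, Q s → Q t → Q ((s + t) / 2)) (y : R) :
    ∃ u, Q u ∧ ∀ t ∈ T, (t < y → t < u) ∧ (y < t → u < t) := by
  classical
  by_cases hlow : ∃ t ∈ T, t < y
  · obtain ⟨t₀, ht₀, ht₀y⟩ := hlow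
    obtain ⟨s, hs, hsy, hsT⟩ := T.exists_lower_neighbor ht₀y
    replace hs : s ∈ T := by rcases hs with rfl | hs <;> assumption
    by_cases hup : ∃ t ∈ T, y < t
    · obtain ⟨t₁, ht₁, ht₁y⟩ := hup
      obtain ⟨r, hr, hyr, hrT⟩ := T.exists_upper_neighbor ht₁y
      replace hr : r ∈ T := by rcases hr with rfl | hr <;> assumption
      refine ⟨(s + r) / 2, hQmid _ _ (hQT _ hs) (hQT _ hr), fun t ht => ⟨fun h => ?_, fun h => ?_⟩⟩
      · linarith [hsT t ht h]
      · linarith [hrT t ht h]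
    · push Not at hup
      exact ⟨s + 1, hQadd _ (hQT _ hs), fun t ht => ⟨fun h => by linarith [hsT t ht h],
        fun h => absurd h (not_lt.2 (hup t ht))⟩⟩
  · push Not at hlow
    by_cases hup : ∃ t ∈ T, y < t
    · obtain ⟨t₁, ht₁, ht₁y⟩ := hup
      obtain ⟨r, hr, hyr, hrT⟩ := T.exists_upper_neighbor ht₁y
      replace hr : r ∈ T := by rcases hr with rfl | hr <;> assumption
      exact ⟨r - 1, hQsub _ (hQT _ hr), fun t ht => ⟨fun h => absurd h (not_lt.2 (hlow t ht)),
        fun h => by linarith [hrT t ht h]⟩⟩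
    · push Not at hup
      exact ⟨0, hQ0, fun t ht => ⟨fun h => absurd h (not_lt.2 (hlow t ht)),
        fun h => absurd h (not_lt.2 (hup t ht))⟩⟩

open Polynomial SignMatching in
/-- Elimination of one variable: finitely many sign conditions with matching coefficients that are
satisfiable in `R` are satisfiable in `S`. -/
theorem SignMatching.exists_sign_eval₂_eq {R S : Type*} [Field R] [LinearOrder R]
    [IsStrictOrderedRing R] [Field S] [LinearOrder S] [IsStrictOrderedRing S]
    (hR : HasPolynomialIVT R) (hS : HasPolynomialIVT S) {Γ : Subring (R × S)}
    (hΓ : SignMatching Γ) (F : Finset Γ[X]) (y : R) :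
    ∃ w : S, ∀ f ∈ F,
      SignType.sign (f.eval₂ (fstHom Γ) y) = SignType.sign (f.eval₂ (sndHom Γ) w) := by
  classical
  let G := F.filter (· ≠ 0)
  have hG : ∀ g ∈ G, g ≠ 0 := fun g hg => (Finset.mem_filter.1 hg).2
  suffices h : ∃ w : S, ∀ f ∈ G,
      SignType.sign (f.eval₂ (fstHom Γ) y) = SignType.sign (f.eval₂ (sndHom Γ) w) by
    obtain ⟨w, hw⟩ := h
    refine ⟨w, fun f hf => ?_⟩
    by_cases hf0 : f = 0
    · simp [hf0]
    · exact hw f (Finset.mem_filter.2 ⟨hf, hf0⟩)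
  obtain ⟨Γ₁, hle₁, hΓ₁, h₁⟩ := (SignMatchingExtends.of_hasPolynomialIVT hR hS
    (G.sup natDegree + 1)).1.extend_roots hΓ G
    fun g hg => ⟨hG g hg, Nat.lt_succ_of_le (Finset.le_sup hg)⟩
  obtain ⟨Δ, hle₂, hΔ, hinv⟩ := hΓ₁.exists_inv_mem
  have hΓΔ : Γ ≤ Δ := hle₁.trans hle₂
  by_cases hy : ∃ g ∈ G, g.eval₂ (fstHom Γ) y = 0
  · obtain ⟨g, hg, hgy⟩ := hy
    obtain ⟨w, hw⟩ := h₁ g hg y hgy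
    exact ⟨w, fun f _ => hΔ _ (eval₂_mem hΓΔ (hle₂ hw) f)⟩
  push Not at hy
  let T : Finset R := G.biUnion fun g => (g.map (fstHom Γ)).roots.toFinset
  have hT : ∀ t, t ∈ T ↔ ∃ g ∈ G, g.eval₂ (fstHom Γ) t = 0 := by
    intro t
    simp only [T, Finset.mem_biUnion, Multiset.mem_toFinset]
    refine exists_congr fun g => and_congr_right fun hg => ?_
    rw [mem_roots ((Polynomial.map_ne_zero_iff hΓ.fstHom_injective).2 (hG g hg)), IsRoot.def,
      eval_map]
  obtain ⟨u, ⟨w, huw⟩, hu⟩ := T.exists_same_side (fun t => ∃ s, (t, s) ∈ Δ)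
    (fun t ht => by
      obtain ⟨g, hg, hgt⟩ := (hT t).1 ht
      obtain ⟨s, hs⟩ := h₁ g hg t hgt
      exact ⟨s, hle₂ hs⟩)
    ⟨0, zero_mem Δ⟩ (fun t ⟨s, hs⟩ => ⟨s - 1, sub_mem hs (one_mem Δ)⟩)
    (fun t ⟨s, hs⟩ => ⟨s + 1, add_mem hs (one_mem Δ)⟩)
    (fun t t' ⟨s, hs⟩ ⟨s', hs'⟩ => ⟨(s + s') / 2, by
      have h2 : ((2 : R)⁻¹, (2 : S)⁻¹) ∈ Δ := hinv (2, 2) (natCast_mem Δ 2)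
      rw [div_eq_mul_inv, div_eq_mul_inv]
      exact mul_mem (add_mem hs hs') h2⟩) y
  refine ⟨w, fun g hg => ?_⟩
  rw [← hΔ _ (eval₂_mem hΓΔ huw g)]
  have h := hR.sign_eq_of_ne_zero (p := g.map (fstHom Γ)) (a := y) (b := u) fun c hc hc' hgc => by
    rw [eval_map] at hgc
    have hcT := (hT c).2 ⟨g, hg, hgc⟩
    rcases lt_trichotomy c y with hcy | rfl | hcy
    · exact absurd hc (not_le.2 (lt_min hcy ((hu c hcT).1 hcy)))
    · exact hy g hg hgc
    · exact absurd hc' (not_le.2 (max_lt hcy ((hu c hcT).2 hcy)))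
  rwa [eval_map, eval_map] at h

theorem Real.hasPolynomialIVT : HasPolynomialIVT ℝ := by
  intro p a b hab h
  have hc : ContinuousOn (fun x => p.eval x) (Set.Icc a b) := p.continuous.continuousOn
  rcases mul_neg_iff.1 h with ⟨ha, hb⟩ | ⟨ha, hb⟩
  · obtain ⟨c, hc, hc0⟩ := intermediate_value_Ioo' hab.le hc ⟨hb, ha⟩
    exact ⟨c, hc.1, hc.2, hc0⟩
  · obtain ⟨c, hc, hc0⟩ := intermediate_value_Ioo hab.le hc ⟨ha, hb⟩
    exact ⟨c, hc.1, hc.2, hc0⟩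

namespace Filter.Germ

open Polynomial

variable {I : Type*} {U : Ultrafilter I}

theorem exists_eval_coe (p : ((U : Filter I).Germ ℝ)[X]) :
    ∃ P : I → ℝ[X], ∀ x : I → ℝ,
      p.eval (x : (U : Filter I).Germ ℝ) = ((fun i => (P i).eval (x i) : I → ℝ) :
        (U : Filter I).Germ ℝ) := by
  induction p using Polynomial.induction_on' with
  | add p q hp hq =>
    obtain ⟨P, hP⟩ := hp
    obtain ⟨Q, hQ⟩ := hq
    refine ⟨fun i => P i + Q i, fun x => ?_⟩
    simp only [eval_add, hP, hQ]
    rfl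
  | monomial n c =>
    induction c using Filter.Germ.inductionOn with
    | _ c =>
      refine ⟨fun i => monomial n (c i), fun x => ?_⟩
      simp only [eval_monomial]
      rfl

theorem sign_coe (g : I → ℝ) (s : SignType) :
    SignType.sign (g : (U : Filter I).Germ ℝ) = s ↔ ∀ᶠ i in (U : Filter I),
      SignType.sign (g i) = s := by
  rcases s.trichotomy with rfl | rfl | rfl
  · simp only [sign_eq_neg_one_iff]
    exact Filter.Germ.coe_lt
  · simp only [sign_eq_zero_iff]
    exact Filter.Germ.coe_eq
  · simp only [sign_eq_one_iff]
    exact Filter.Germ.coe_pos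

theorem hasPolynomialIVT : HasPolynomialIVT ((U : Filter I).Germ ℝ) := by
  intro p a b hab h
  induction a using Filter.Germ.inductionOn with
  | _ a =>
  induction b using Filter.Germ.inductionOn with
  | _ b =>
  obtain ⟨P, hP⟩ := exists_eval_coe p
  rw [hP, hP] at h
  have h' : ∀ᶠ i in (U : Filter I), (P i).eval (a i) * (P i).eval (b i) < 0 :=
    Filter.Germ.coe_lt.1 h
  have key : ∀ᶠ i in (U : Filter I), ∃ c, a i < c ∧ c < b i ∧ (P i).eval c = 0 := by
    filter_upwards [h', Filter.Germ.coe_lt.1 hab] with i hi hi'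
    exact Real.hasPolynomialIVT _ _ _ hi' hi
  choose! c hc using fun i (h : ∃ c, a i < c ∧ c < b i ∧ (P i).eval c = 0) => h
  refine ⟨(c : (U : Filter I).Germ ℝ), Filter.Germ.coe_lt.2 ?_, Filter.Germ.coe_lt.2 ?_, ?_⟩
  · exact key.mono fun i hi => (hc i hi).1
  · exact key.mono fun i hi => (hc i hi).2.1
  · rw [hP]
    exact Filter.Germ.coe_eq.2 (key.mono fun i hi => (hc i hi).2.2)

end Filter.Germ

open MvPolynomial in
theorem MvPolynomial.eval₂_finSuccEquiv {R S : Type*} [CommSemiring R] [CommSemiring S] {d : ℕ}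
    (φ : MvPolynomial (Fin d) R →+* S) (y : S) (f : MvPolynomial (Fin (d + 1)) R) :
    (finSuccEquiv R d f).eval₂ φ y =
      eval₂Hom (φ.comp C) (Fin.cons y fun i => φ (X i) : Fin (d + 1) → S) f := by
  have h : (Polynomial.eval₂RingHom φ y).comp (finSuccEquiv R d).toRingEquiv.toRingHom =
      eval₂Hom (φ.comp C) (Fin.cons y fun i => φ (X i) : Fin (d + 1) → S) := by
    refine MvPolynomial.ringHom_ext (fun r => ?_) fun i => ?_
    · simp [finSuccEquiv_apply]
    · refine Fin.cases ?_ (fun j => ?_) i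
      · simp [finSuccEquiv_X_zero]
      · simp [finSuccEquiv_X_succ]
  exact DFunLike.congr_fun h f

theorem RingHom.sign_map_real {L : Type*} [Field L] [LinearOrder L]
    [IsStrictOrderedRing L] (ι : ℝ →+* L) (c : ℝ) : SignType.sign (ι c) = SignType.sign c := by
  have key : ∀ c : ℝ, 0 < c → 0 < ι c := fun c hc => by
    rw [← Real.mul_self_sqrt hc.le, map_mul]
    exact mul_self_pos.2 ((map_ne_zero ι).2 (Real.sqrt_pos.2 hc).ne')
  rcases lt_trichotomy c 0 with hc | rfl | hc
  · rw [sign_neg hc, sign_neg]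
    simpa using key (-c) (neg_pos.2 hc)
  · simp
  · rw [sign_pos hc, sign_pos (key c hc)]

open MvPolynomial SignMatching in
/-- The transfer principle: a finite system of polynomial sign conditions with real coefficients
that is satisfiable in a real closed extension of `ℝ` is satisfiable in `ℝ`. -/
theorem HasPolynomialIVT.exists_sign_eval_eq {L : Type*} [Field L] [LinearOrder L]
    [IsStrictOrderedRing L] (hL : HasPolynomialIVT L) (ι : ℝ →+* L) {d : ℕ} (a : Fin d → L)
    (F : Finset (MvPolynomial (Fin d) ℝ)) :
    ∃ b : Fin d → ℝ, ∀ f ∈ F,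
      SignType.sign (eval₂Hom ι a f) = SignType.sign (eval b f) := by
  induction d with
  | zero =>
    refine ⟨Fin.elim0, fun f _ => ?_⟩
    obtain ⟨c, rfl⟩ := C_surjective (Fin 0) f
    simpa using ι.sign_map_real c
  | succ d ih =>
    classical
    let A := MvPolynomial (Fin d) ℝ
    choose b hb using ih (Fin.tail a)
    let U : Ultrafilter (Finset A) := Ultrafilter.of Filter.atTop
    have hU : (U : Filter (Finset A)) ≤ Filter.atTop := Ultrafilter.of_le _
    let ψ : A →+* (U : Filter (Finset A)).Germ ℝ :=
      (Filter.Germ.coeRingHom (U : Filter (Finset A))).comp (RingHom.pi fun S => eval (b S))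
    have hψ : ∀ p, ψ p = ((fun S => eval (b S) p : Finset A → ℝ) :
      (U : Filter (Finset A)).Germ ℝ) := fun p => rfl
    let φ : A →+* L := eval₂Hom ι (Fin.tail a)
    let Γ := (φ.prod ψ).range
    have hΓ : SignMatching Γ := by
      rintro _ ⟨p, rfl⟩
      refine Eq.symm ((Filter.Germ.sign_coe _ _).2 ?_)
      filter_upwards [hU (Filter.eventually_ge_atTop {p})] with S hS
      exact (hb S p (Finset.singleton_subset_iff.1 hS)).symm
    let ρ : A →+* Γ := (φ.prod ψ).rangeRestrict
    obtain ⟨w, hw⟩ := hΓ.exists_sign_eval₂_eq hL Filter.Germ.hasPolynomialIVT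
      (F.image fun f => (finSuccEquiv ℝ d f).map ρ) (a 0)
    induction w using Filter.Germ.inductionOn with
    | _ w =>
    have h : ∀ f ∈ F, ∀ᶠ S in (U : Filter (Finset A)), SignType.sign (eval₂Hom ι a f) =
        SignType.sign (eval (Fin.cons (w S) (b S) : Fin (d + 1) → ℝ) f) := by
      intro f hf
      have h1 := hw _ (Finset.mem_image_of_mem _ hf)
      rw [Polynomial.eval₂_map, Polynomial.eval₂_map] at h1
      have h2 : (finSuccEquiv ℝ d f).eval₂ ((fstHom Γ).comp ρ) (a 0) = eval₂Hom ι a f := by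
        have h4 : ((fstHom Γ).comp ρ).comp C = ι := RingHom.ext fun c => eval₂Hom_C ι _ c
        have h5 : (Fin.cons (a 0) fun i => (fstHom Γ).comp ρ (X i) : Fin (d + 1) → L) = a := by
          funext i
          refine Fin.cases rfl (fun j => ?_) i
          exact eval₂Hom_X' ι (Fin.tail a) j
        rw [eval₂_finSuccEquiv, h4, h5]
      have h3 : (finSuccEquiv ℝ d f).eval₂ ((sndHom Γ).comp ρ) w =
          ((fun S => eval (Fin.cons (w S) (b S) : Fin (d + 1) → ℝ) f : Finset A → ℝ) :
            (U : Filter (Finset A)).Germ ℝ) := by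
        let χ : MvPolynomial (Fin (d + 1)) ℝ →+* (U : Filter (Finset A)).Germ ℝ :=
          (Filter.Germ.coeRingHom (U : Filter (Finset A))).comp
            (RingHom.pi fun S => eval (Fin.cons (w S) (b S) : Fin (d + 1) → ℝ))
        have h4 : eval₂Hom (((sndHom Γ).comp ρ).comp C)
            (Fin.cons (w : (U : Filter (Finset A)).Germ ℝ)
              fun i => (sndHom Γ).comp ρ (X i) : Fin (d + 1) → _) = χ := by
          refine MvPolynomial.ringHom_ext (fun r => ?_) fun i => ?_
          · rw [eval₂Hom_C]
            refine Filter.Germ.coe_eq.2 (Filter.Eventually.of_forall fun S => ?_)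
            exact (eval_C r).trans (eval_C r).symm
          · rw [eval₂Hom_X']
            refine Fin.cases ?_ (fun j => ?_) i
            · refine Filter.Germ.coe_eq.2 (Filter.Eventually.of_forall fun S => ?_)
              exact (eval_X (f := (Fin.cons (w S) (b S) : Fin (d + 1) → ℝ)) 0).symm
            · refine Filter.Germ.coe_eq.2 (Filter.Eventually.of_forall fun S => ?_)
              exact (eval_X (f := b S) j).trans
                (eval_X (f := (Fin.cons (w S) (b S) : Fin (d + 1) → ℝ)) j.succ).symm
        rw [eval₂_finSuccEquiv, h4]
        rfl
      rw [h2, h3] at h1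
      exact ((Filter.Germ.sign_coe _ _).1 h1.symm).mono fun S hS => hS.symm
    obtain ⟨S, hS⟩ := ((Filter.eventually_all_finset F).2 h).exists
    exact ⟨_, hS⟩

theorem IsSumSq.map {R S F : Type*} [NonAssocSemiring R] [NonAssocSemiring S] [FunLike F R S]
    [RingHomClass F R S] (f : F) {s : R} (hs : IsSumSq s) : IsSumSq (f s) := by
  induction hs with
  | zero => simp
  | sq_add a _ ih =>
    rw [map_add, map_mul]
    exact .sq_add _ ih

theorem IsSumSq.exists_map_eq {R S F : Type*} [NonAssocSemiring R] [NonAssocSemiring S]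
    [FunLike F R S] [RingHomClass F R S] {f : F} (hf : Function.Surjective f) {s : S}
    (hs : IsSumSq s) : ∃ r, IsSumSq r ∧ f r = s := by
  induction hs with
  | zero => exact ⟨0, .zero, map_zero f⟩
  | sq_add a _ ih =>
    obtain ⟨r, hr, rfl⟩ := ih
    obtain ⟨b, rfl⟩ := hf a
    exact ⟨b * b + r, .sq_add b hr, by rw [map_add, map_mul]⟩

namespace Polynomial

theorem exists_irreducible_dvd_mul_eval_neg {R : Type*} [Field R] [LinearOrder R]
    [IsStrictOrderedRing R] {p : R[X]} {a b : R} (h : p.eval a * p.eval b < 0) :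
    ∃ q, Irreducible q ∧ q ∣ p ∧ q.eval a * q.eval b < 0 := by
  induction p using WfDvdMonoid.induction_on_irreducible with
  | zero => simp at h
  | unit u hu =>
    obtain ⟨c, -, rfl⟩ := isUnit_iff.1 hu
    simp only [eval_C] at h
    exact absurd h (not_lt.2 (mul_self_nonneg c))
  | mul p q _ hq ih =>
    by_cases hqab : q.eval a * q.eval b < 0
    · exact ⟨q, hq, dvd_mul_right q p, hqab⟩
    · have hp : p.eval a * p.eval b < 0 := by
        by_contra hp
        refine absurd h (not_lt.2 ?_)
        rw [eval_mul, eval_mul, mul_mul_mul_comm]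
        exact mul_nonneg (not_lt.1 hqab) (not_lt.1 hp)
      obtain ⟨r, hr, hrp, hrab⟩ := ih hp
      exact ⟨r, hr, hrp.mul_left q, hrab⟩

theorem exists_isSumSq_natDegree_le {R : Type*} [Field R] {p : R[X]} (hp : 0 < p.natDegree)
    {s : R[X]} (hs : IsSumSq s) :
    ∃ t, IsSumSq t ∧ p ∣ s - t ∧ t.natDegree ≤ 2 * (p.natDegree - 1) := by
  induction hs with
  | zero => exact ⟨0, .zero, by simp, by simp⟩
  | @sq_add a s _ ih =>
    obtain ⟨t, ht, hst, htd⟩ := ih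
    refine ⟨a % p * (a % p) + t, .sq_add _ ht, ?_, ?_⟩
    · have h : p ∣ a - a % p := by
        refine ⟨a / p, ?_⟩
        rw [sub_eq_iff_eq_add]
        exact (EuclideanDomain.div_add_mod a p).symm
      have : a * a + s - (a % p * (a % p) + t) = (a - a % p) * (a + a % p) + (s - t) := by ring
      rw [this]
      exact dvd_add (h.mul_right _) hst
    · have h : (a % p).natDegree < p.natDegree := natDegree_mod_lt a hp.ne'
      refine (natDegree_add_le _ _).trans (max_le (natDegree_mul_le.trans ?_) htd)
      omega

/-- An irreducible polynomial changing sign is real. -/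
theorem _root_.Irreducible.not_dvd_one_add_of_isSumSq {R : Type*} [Field R] [LinearOrder R]
    [IsStrictOrderedRing R] {p : R[X]} (hp : Irreducible p) {a b : R}
    (h : p.eval a * p.eval b < 0) {s : R[X]} (hs : IsSumSq s) : ¬ p ∣ 1 + s := by
  induction hn : p.natDegree using Nat.strong_induction_on generalizing p s with
  | _ n ih =>
  intro hps
  obtain ⟨t, ht, hst, htd⟩ := exists_isSumSq_natDegree_le hp.natDegree_pos hs
  obtain ⟨r, hr⟩ : p ∣ 1 + t := by
    have := dvd_sub hps hst
    rwa [show 1 + s - (s - t) = 1 + t by ring] at this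
  have hpos : ∀ c, 0 < (1 + t).eval c := fun c => by
    rw [eval_add, eval_one]
    exact add_pos_of_pos_of_nonneg one_pos (ht.map (evalRingHom c)).nonneg
  have hr0 : r ≠ 0 := by
    rintro rfl
    have := hpos 0
    rw [hr] at this
    simp at this
  have hrab : r.eval a * r.eval b < 0 := by
    have := mul_pos (hpos a) (hpos b)
    rw [hr, eval_mul, eval_mul, mul_mul_mul_comm] at this
    exact neg_of_mul_pos_right this h.le
  obtain ⟨q, hq, hqr, hqab⟩ := exists_irreducible_dvd_mul_eval_neg hrab
  have hdeg : p.natDegree + r.natDegree ≤ 2 * (p.natDegree - 1) := by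
    rw [← natDegree_mul hp.ne_zero hr0, ← hr]
    exact (natDegree_add_le _ _).trans (max_le (by simp) htd)
  have hqd := natDegree_le_of_dvd hqr hr0
  have := hp.natDegree_pos
  exact ih q.natDegree (by omega) hq hqab ht rfl (hqr.trans ⟨p, by rw [hr, mul_comm]⟩)

end Polynomial

open Polynomial in
theorem HasPolynomialIVT.of_exists_root {R : Type*} [Field R] [LinearOrder R]
    [IsStrictOrderedRing R]
    (hroot : ∀ q : R[X], Irreducible q → (∀ s, IsSumSq s → ¬ q ∣ 1 + s) → ∃ c, q.eval c = 0) :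
    HasPolynomialIVT R := by
  intro p a b hab h
  obtain ⟨q, hq, hqp, hqab⟩ := exists_irreducible_dvd_mul_eval_neg h
  obtain ⟨c, hc⟩ := hroot q hq fun s hs => hq.not_dvd_one_add_of_isSumSq hqab hs
  obtain ⟨u, hu⟩ := ((irreducible_X_sub_C c).associated_of_dvd hq (dvd_iff_isRoot.2 hc))
  obtain ⟨v, -, hv⟩ := isUnit_iff.1 u.isUnit
  rw [← hv] at hu
  have hc' : (a - c) * (b - c) < 0 := by
    rw [← hu] at hqab
    simp only [eval_mul, eval_sub, eval_X, eval_C] at hqab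
    have h2 : (a - c) * (b - c) * (v * v) < 0 := by linarith
    exact neg_of_mul_neg_left h2 (mul_self_nonneg v)
  refine ⟨c, ?_, ?_, eval_eq_zero_of_dvd_of_eval_eq_zero hqp hc⟩
  · by_contra hac
    nlinarith
  · by_contra hac
    nlinarith

open Polynomial in
theorem isSumSq_neg_of_not_isSquare {R : Type*} [Field R] (hR : ¬ IsSumSq (-1 : R))
    (hroot : ∀ q : R[X], Irreducible q → (∀ s, IsSumSq s → ¬ q ∣ 1 + s) → ∃ c, q.eval c = 0)
    {a : R} (ha : ¬ IsSquare a) : IsSumSq (-a) := by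
  have hmonic : (X ^ 2 - C a).Monic := monic_X_pow_sub_C a two_ne_zero
  have hdeg : (X ^ 2 - C a).natDegree = 2 := natDegree_X_pow_sub_C
  have hirr : Irreducible (X ^ 2 - C a) := by
    rw [irreducible_iff_roots_eq_zero_of_degree_le_three hdeg.ge (by omega)]
    refine Multiset.eq_zero_of_forall_notMem fun c hc => ha ⟨c, ?_⟩
    have := (mem_roots'.1 hc).2
    simp only [IsRoot.def, eval_sub, eval_pow, eval_X, eval_C, sub_eq_zero] at this
    rw [← this, sq]
  have key : ∀ s : R[X], IsSumSq s → ∃ b c v : R, IsSumSq b ∧ IsSumSq c ∧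
      X ^ 2 - C a ∣ s - (C (b + a * c) + C v * X) := by
    intro s hs
    induction hs with
    | zero => exact ⟨0, 0, 0, .zero, .zero, by simp⟩
    | @sq_add p s _ ih =>
      obtain ⟨b, c, v, hb, hc, hs⟩ := ih
      obtain ⟨z, x, y, hp⟩ : ∃ (z : R[X]) (x y : R), p = C x + C y * X + (X ^ 2 - C a) * z := by
        have h : (p %ₘ (X ^ 2 - C a)).natDegree < 2 :=
          (natDegree_modByMonic_lt p hmonic fun h => by simp [h] at hdeg).trans_eq hdeg
        obtain ⟨y, x, h⟩ := exists_eq_X_add_C_of_natDegree_le_one (Nat.le_of_lt_succ h)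
        exact ⟨_, x, y, by rw [add_comm (C x), ← h, modByMonic_add_div]⟩
      refine ⟨x * x + b, y * y + c, 2 * x * y + v, .sq_add _ hb, .sq_add _ hc, ?_⟩
      obtain ⟨w, hw⟩ := hs
      refine ⟨z * (p + (C x + C y * X)) + C (y * y) + w, ?_⟩
      rw [sub_eq_iff_eq_add] at hw
      rw [hw, hp]
      simp only [C_add, C_mul, C_ofNat]
      ring
  by_contra hna
  have hno : ∀ s, IsSumSq s → ¬ X ^ 2 - C a ∣ 1 + s := by
    intro s hs hdvd
    obtain ⟨b, c, v, hb, hc, hs⟩ := key s hs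
    have h1 : X ^ 2 - C a ∣ C (1 + b + a * c) + C v * X := by
      have := dvd_sub hdvd hs
      convert this using 1
      simp only [C_add, C_1]
      ring
    have h2 : C v * X + C (1 + b + a * c) = 0 := by
      rw [add_comm]
      refine eq_zero_of_dvd_of_natDegree_lt h1 ?_
      rw [hdeg, add_comm]
      exact Nat.lt_succ_of_le natDegree_linear_le
    have h3 : 1 + b + a * c = 0 := by simpa using congrArg (eval 0) h2
    by_cases hc0 : c = 0
    · refine hR ?_
      rw [hc0, mul_zero, add_zero] at h3
      rwa [← eq_neg_of_add_eq_zero_right h3]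
    · refine hna ?_
      have : -a = (1 + b) * c * (c⁻¹ * c⁻¹) := by
        field_simp
        linear_combination -h3
      rw [this]
      exact ((IsSumSq.one.add hb).mul hc).mul (.mul_self _)
  obtain ⟨c, hc⟩ := hroot _ hirr hno
  refine ha ⟨c, ?_⟩
  simp only [eval_sub, eval_pow, eval_X, eval_C, sub_eq_zero] at hc
  rw [← hc, sq]

theorem IsSumSq.exists_linearOrder {R : Type*} [Field R] (hR : ¬ IsSumSq (-1 : R))
    (h : ∀ a : R, ¬ IsSquare a → IsSumSq (-a)) :
    ∃ _ : LinearOrder R, IsStrictOrderedRing R := by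
  classical
  let P : RingCone R :=
    { Subsemiring.sumSq R with
      eq_zero_of_mem_of_neg_mem' := by
        intro a ha hna
        by_contra h0
        refine hR ?_
        have : (-1 : R) = -a * a * (a⁻¹ * a⁻¹) := by field_simp
        rw [this]
        exact ((Subsemiring.mem_sumSq.1 hna).mul (Subsemiring.mem_sumSq.1 ha)).mul (.mul_self _) }
  have hP : ∀ a, a ∈ P ↔ IsSumSq a := fun a => Subsemiring.mem_sumSq
  have : HasMemOrNegMem P := ⟨fun a => by
    rw [hP, hP]
    by_cases ha : IsSquare a
    · exact Or.inl ha.isSumSq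
    · exact Or.inr (h a ha)⟩
  let _ := LinearOrder.mkOfAddGroupCone P
  have : IsOrderedRing R := IsOrderedRing.mkOfCone P
  exact ⟨inferInstance, inferInstance⟩

open Polynomial in
theorem exists_subfield_isSumSq_maximal (K : Type*) [Field K] (hK : ¬ IsSumSq (-1 : K)) :
    ∃ E : Subfield (AlgebraicClosure K), (algebraMap K (AlgebraicClosure K)).fieldRange ≤ E ∧
      ¬ IsSumSq (-1 : E) ∧ ∀ q : E[X], Irreducible q → (∀ s, IsSumSq s → ¬ q ∣ 1 + s) →
        ∃ c, q.eval c = 0 := by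
  obtain ⟨E, hKE, hE⟩ := zorn_le_nonempty₀ {E : Subfield (AlgebraicClosure K) | ¬ IsSumSq (-1 : E)}
    (fun c hc hchain E hE => by
      refine ⟨sSup c, fun h => ?_, fun F hF => le_sSup hF⟩
      have key : ∀ z : (sSup c : Subfield (AlgebraicClosure K)), IsSumSq z →
          ∃ F ∈ c, ∃ w : F, IsSumSq w ∧ (w : AlgebraicClosure K) = z := by
        intro z hz
        induction hz with
        | zero => exact ⟨E, hE, 0, .zero, rfl⟩
        | @sq_add a s _ ih =>
          obtain ⟨F, hF, w, hw, hws⟩ := ih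
          obtain ⟨F', hF', haF'⟩ :=
            (Subfield.mem_sSup_of_directedOn ⟨E, hE⟩ hchain.directedOn).1 a.2
          obtain ⟨G, hG, hFG, hFG'⟩ := hchain.directedOn F hF F' hF'
          let b : G := ⟨a, hFG' haF'⟩
          refine ⟨G, hG, b * b + Subfield.inclusion hFG w, .sq_add _ (hw.map _), ?_⟩
          exact congrArg ((a : AlgebraicClosure K) * a + ·) hws
      obtain ⟨F, hF, w, hw, hw1⟩ := key _ h
      refine hc hF ?_
      convert hw
      exact Subtype.ext hw1.symm)
    (algebraMap K (AlgebraicClosure K)).fieldRange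
    (fun h => hK (by
      obtain ⟨r, hr, hr1⟩ := h.exists_map_eq
        (algebraMap K (AlgebraicClosure K)).rangeRestrictField_bijective.2
      rw [← map_one (algebraMap K (AlgebraicClosure K)).rangeRestrictField, ← map_neg] at hr1
      rwa [← (algebraMap K (AlgebraicClosure K)).rangeRestrictField_bijective.1 hr1]))
  refine ⟨E, hKE, hE.prop, fun q hq hqs => ?_⟩
  obtain ⟨c, hc⟩ := IsAlgClosed.exists_eval₂_eq_zero E.subtype q hq.degree_pos.ne'
  have : Fact (Irreducible q) := ⟨hq⟩
  let f : AdjoinRoot q →+* AlgebraicClosure K := AdjoinRoot.lift E.subtype c hc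
  have hEf : E ≤ f.fieldRange := fun x hx =>
    ⟨AdjoinRoot.of q ⟨x, hx⟩, AdjoinRoot.lift_of hc⟩
  have hf : ¬ IsSumSq (-1 : f.fieldRange) := fun h => by
    obtain ⟨r, hr, hr1⟩ := h.exists_map_eq f.rangeRestrictField_bijective.2
    rw [← map_one f.rangeRestrictField, ← map_neg] at hr1
    obtain ⟨s, hs, hs1⟩ := hr.exists_map_eq (AdjoinRoot.mk_surjective (g := q))
    refine hqs s hs (AdjoinRoot.mk_eq_zero.1 ?_)
    rw [map_add, hs1, f.rangeRestrictField_bijective.1 hr1, map_one, add_neg_cancel]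
  have hcE : c ∈ E := hE.le_of_ge hf hEf ⟨AdjoinRoot.root q, AdjoinRoot.lift_root hc⟩
  refine ⟨⟨c, hcE⟩, Subtype.ext ?_⟩
  have := hom_eval₂ q (RingHom.id E) E.subtype ⟨c, hcE⟩
  rw [RingHom.comp_id] at this
  exact this.trans hc

/-- The Artin–Schreier theorem: a real field embeds into a real closed field. -/
theorem exists_hasPolynomialIVT.{u} (K : Type u) [Field K] (hK : ¬ IsSumSq (-1 : K)) :
    ∃ (L : Type u) (_ : Field L) (_ : LinearOrder L) (_ : IsStrictOrderedRing L),
      Nonempty (K →+* L) ∧ HasPolynomialIVT L := by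
  obtain ⟨E, hKE, hE, hroot⟩ := exists_subfield_isSumSq_maximal K hK
  obtain ⟨_, _⟩ := IsSumSq.exists_linearOrder hE fun a => isSumSq_neg_of_not_isSquare hE hroot
  exact ⟨E, inferInstance, inferInstance, inferInstance,
    ⟨(Subfield.inclusion hKE).comp (algebraMap K _).rangeRestrictField⟩, .of_exists_root hroot⟩

theorem Ideal.exists_isPrime_of_pow_add_notMem {A : Type*} [CommRing A] [IsNoetherianRing A]
    (N : Ideal A) (f : A) (hf : ∀ m s, IsSumSq s → f ^ (2 * m) + s ∉ N) :
    ∃ J : Ideal A, N ≤ J ∧ J.IsPrime ∧ f ∉ J ∧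
      ∀ d s, IsSumSq s → d * d + s ∈ J → d ∈ J := by
  obtain ⟨J, ⟨hNJ, hJ⟩, hmax⟩ := (wellFounded_gt (α := Ideal A)).has_min
    {J | N ≤ J ∧ ∀ m s, IsSumSq s → f ^ (2 * m) + s ∉ J} ⟨N, le_rfl, hf⟩
  have hpow : ∀ m, IsSumSq (f ^ (2 * m)) := fun m => by
    rw [two_mul, pow_add]
    exact .mul_self _
  have key : ∀ a ∉ J, ∃ m s x, IsSumSq s ∧ f ^ (2 * m) + s - x * a ∈ J := by
    intro a ha
    by_contra! h
    refine hmax (J ⊔ Ideal.span {a}) ⟨hNJ.trans le_sup_left, fun m s hs hmem => ?_⟩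
      (lt_of_le_of_ne le_sup_left fun h => ha ?_)
    · obtain ⟨j, hj, y, hy, hjy⟩ := Submodule.mem_sup.1 hmem
      obtain ⟨x, rfl⟩ := Ideal.mem_span_singleton'.1 hy
      refine h m s x hs ?_
      rwa [← hjy, add_sub_cancel_right]
    · rw [h]
      exact Ideal.mem_sup_right (Ideal.mem_span_singleton_self a)
  refine ⟨J, hNJ, ⟨?_, ?_⟩, fun h => ?_, fun d s hs hd => ?_⟩
  · exact fun h => hJ 0 0 .zero (h ▸ Submodule.mem_top)
  · intro a b hab
    by_contra! h
    obtain ⟨m, s, x, hs, hx⟩ := key a h.1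
    obtain ⟨k, t, y, ht, hy⟩ := key b h.2
    refine hJ (m + k) (f ^ (2 * m) * t + s * f ^ (2 * k) + s * t)
      ((((hpow m).mul ht).add (hs.mul (hpow k))).add (hs.mul ht)) ?_
    have := add_mem (add_mem (J.mul_mem_right (f ^ (2 * k) + t) hx)
      (J.mul_mem_left (x * a) hy)) (J.mul_mem_left (x * y) hab)
    convert this using 1
    ring
  · refine hJ 1 0 .zero ?_
    rw [add_zero]
    exact J.pow_mem_of_mem h _ (by norm_num)
  · by_contra hdJ
    obtain ⟨m, t, x, ht, hx⟩ := key d hdJ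
    refine hJ (m + m) (f ^ (2 * m) * t + t * f ^ (2 * m) + t * t + x * x * s)
      (((((hpow m).mul ht).add (ht.mul (hpow m))).add (.mul_self t)).add
        ((IsSumSq.mul_self x).mul hs)) ?_
    have := add_mem (J.mul_mem_right (f ^ (2 * m) + t + x * d) hx) (J.mul_mem_left (x * x) hd)
    convert this using 1
    ring

theorem IsSumSq.exists_mul_eq_algebraMap {D K : Type*} [CommRing D] [IsDomain D] [Field K]
    [Algebra D K] [IsFractionRing D K] {z : K} (hz : IsSumSq z) :
    ∃ d : D, d ≠ 0 ∧ ∃ s, IsSumSq s ∧ algebraMap D K (d * d) * z = algebraMap D K s := by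
  induction hz with
  | zero => exact ⟨1, one_ne_zero, 0, .zero, by simp⟩
  | @sq_add a z _ ih =>
    obtain ⟨d, hd, s, hs, h⟩ := ih
    obtain ⟨x, y, hy, rfl⟩ := IsFractionRing.div_surjective (A := D) a
    have hy0 : y ≠ 0 := nonZeroDivisors.ne_zero hy
    refine ⟨d * y, mul_ne_zero hd hy0, d * d * (x * x) + y * y * s,
      ((IsSumSq.mul_self d).mul (.mul_self x)).add ((IsSumSq.mul_self y).mul hs), ?_⟩
    have hy' : algebraMap D K y ≠ 0 := by simpa using hy0
    simp only [map_mul, map_add] at h ⊢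
    rw [← h]
    field_simp

open MvPolynomial in
/-- The real Nullstellensatz. -/
theorem MvPolynomial.exists_eval_ne_zero_of_real {n : ℕ} (N : Ideal (MvPolynomial (Fin n) ℝ))
    (hN : ∀ g s, IsSumSq s → g * g + s ∈ N → g ∈ N) {f : MvPolynomial (Fin n) ℝ} (hf : f ∉ N) :
    ∃ x : Fin n → ℝ, (∀ p ∈ N, eval x p = 0) ∧ eval x f ≠ 0 := by
  classical
  have hrad : N.IsRadical := (Ideal.isRadical_iff_pow_one_lt 2 one_lt_two).2 fun g hg =>
    hN g 0 .zero (by rwa [add_zero, ← sq])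
  obtain ⟨J, hNJ, hJ, hfJ, hreal⟩ := N.exists_isPrime_of_pow_add_notMem f fun m s hs h =>
    hf (hrad ⟨m, hN _ s hs (by rwa [← pow_add, ← two_mul])⟩)
  let D := MvPolynomial (Fin n) ℝ ⧸ J
  let K := FractionRing D
  have hK : ¬ IsSumSq (-1 : K) := fun h => by
    obtain ⟨d, hd, s, hs, hds⟩ := h.exists_mul_eq_algebraMap (D := D)
    obtain ⟨d, rfl⟩ := Ideal.Quotient.mk_surjective d
    obtain ⟨s, hs', rfl⟩ := hs.exists_map_eq Ideal.Quotient.mk_surjective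
    refine hd (Ideal.Quotient.eq_zero_iff_mem.2
      (hreal d s hs' (Ideal.Quotient.eq_zero_iff_mem.1 ?_)))
    refine IsFractionRing.injective D K ?_
    rw [map_add, map_add, ← hds, map_mul, map_zero]
    ring
  obtain ⟨L, _, _, _, ⟨φ⟩, hL⟩ := exists_hasPolynomialIVT K hK
  let θ : MvPolynomial (Fin n) ℝ →+* L :=
    φ.comp ((algebraMap D K).comp (Ideal.Quotient.mk J))
  have hθ : ∀ p, θ p = 0 ↔ p ∈ J := fun p => by
    change φ (algebraMap D K (Ideal.Quotient.mk J p)) = 0 ↔ _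
    rw [map_eq_zero, FaithfulSMul.algebraMap_eq_zero_iff, Ideal.Quotient.eq_zero_iff_mem]
  have hθ' : eval₂Hom (θ.comp C) (fun i => θ (X i)) = θ :=
    MvPolynomial.ringHom_ext (fun r => eval₂Hom_C _ _ r) fun i => eval₂Hom_X' _ _ i
  obtain ⟨G, hG⟩ := IsNoetherian.noetherian J
  obtain ⟨x, hx⟩ := hL.exists_sign_eval_eq (θ.comp C) (fun i => θ (X i)) (insert f G)
  rw [hθ'] at hx
  have hx' : ∀ p ∈ insert f G, eval x p = 0 ↔ p ∈ J := fun p hp => by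
    rw [← hθ, ← sign_eq_zero_iff, ← hx p hp, sign_eq_zero_iff]
  refine ⟨x, fun p hp => ?_, fun h => hfJ ((hx' f (Finset.mem_insert_self f G)).1 h)⟩
  have hle : J ≤ RingHom.ker (eval x) := by
    rw [← hG, Submodule.span_le]
    exact fun g hg => (hx' g (Finset.mem_insert_of_mem hg)).2 (hG ▸ Submodule.subset_span hg)
  exact hle (hNJ hp)

/-- The radical of the bilinear form `(P, Q) ↦ Λ (P * Q)`. -/
def nullIdealR {n : ℕ} (Λ : MvPolynomial (Fin n) ℝ →ₗ[ℝ] ℝ) :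
    Ideal (MvPolynomial (Fin n) ℝ) where
  carrier := {P | ∀ Q, Λ (P * Q) = 0}
  add_mem' ha hb Q := by rw [add_mul, map_add, ha Q, hb Q, add_zero]
  zero_mem' Q := by rw [zero_mul, map_zero]
  smul_mem' c a ha Q := by rw [smul_eq_mul, mul_comm c, mul_assoc]; exact ha (c * Q)

theorem IsPosDefR.mem_nullIdealR {n : ℕ} {Λ : MvPolynomial (Fin n) ℝ →ₗ[ℝ] ℝ}
    (hΛ : IsPosDefR Λ) {P : MvPolynomial (Fin n) ℝ} : P ∈ nullIdealR Λ ↔ P ∈ nSetR Λ := by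
  refine ⟨fun h => ?_, fun h Q => ?_⟩
  · change Λ (P ^ 2) = 0
    rw [sq]
    exact h P
  · change Λ (P ^ 2) = 0 at h
    by_contra hPQ
    obtain ⟨t, ht⟩ : ∃ t : ℝ, 2 * t * Λ (P * Q) = -(Λ (Q ^ 2) + 1) :=
      ⟨-(Λ (Q ^ 2) + 1) / (2 * Λ (P * Q)), by field_simp⟩
    have key := hΛ (Q + t • P)
    rw [show (Q + t • P) ^ 2 = Q ^ 2 + (2 * t) • (P * Q) + (t ^ 2) • P ^ 2 by
      simp only [MvPolynomial.smul_eq_C_mul, map_mul, map_pow, map_ofNat]; ring] at key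
    simp only [map_add, map_smul, smul_eq_mul, h, ht] at key
    linarith

theorem IsPosDefR.nonneg_of_isSumSq {n : ℕ} {Λ : MvPolynomial (Fin n) ℝ →ₗ[ℝ] ℝ}
    (hΛ : IsPosDefR Λ) {s : MvPolynomial (Fin n) ℝ} (hs : IsSumSq s) : 0 ≤ Λ s := by
  induction hs with
  | zero => rw [map_zero]
  | sq_add a _ ih =>
    rw [map_add, ← sq]
    exact add_nonneg (hΛ a) ih

theorem stmt_12 (n : ℕ) (hn : 0 < n)
    (Λ : MvPolynomial (Fin n) ℝ →ₗ[ℝ] ℝ) (hΛ : IsPosDefR Λ) :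
    ∃ Z : Set (Fin n → ℝ),
      nSetR Λ = (vanishingIdealR Z : Set (MvPolynomial (Fin n) ℝ)) := by
  refine ⟨zeroSetR (nullIdealR Λ), Set.ext fun P => ?_⟩
  rw [← hΛ.mem_nullIdealR]
  refine ⟨fun hP x hx => hx P hP, fun hP => ?_⟩
  by_contra hPN
  have hreal : ∀ g s, IsSumSq s → g * g + s ∈ nullIdealR Λ → g ∈ nullIdealR Λ := by
    intro g s hs h
    have h1 : Λ (g ^ 2) + Λ s = 0 := by
      rw [← map_add, sq, ← mul_one (g * g + s)]
      exact h 1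
    refine hΛ.mem_nullIdealR.2 (?_ : Λ (g ^ 2) = 0)
    linarith [hΛ g, hΛ.nonneg_of_isSumSq hs]
  obtain ⟨x, hx, hxP⟩ := MvPolynomial.exists_eval_ne_zero_of_real (nullIdealR Λ) hreal hPN
  exact hxP (hP x hx)
end

section
/- Let Λ : ℂ[X₁,…,Xₙ] → ℂ be a positive definite linear functional. Then N(Λ) := {P ∈ ℂ[X₁,…,Xₙ] : Λ(P*P) = 0} is a set ideal: there exists a subset Z of ℝⁿ such that N(Λ) = I_ℂ(Z). Moreover, N(Λ) is the greatest ideal of ℂ[X₁,…,Xₙ] contained in the kernel of Λ. -/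
open MeasureTheory
open scoped ComplexOrder

noncomputable def evalC {n : ℕ} (P : MvPolynomial (Fin n) ℂ) (x : Fin n → ℝ) : ℂ :=
  MvPolynomial.aeval (fun i => (x i : ℂ)) P

noncomputable def starC {n : ℕ} (P : MvPolynomial (Fin n) ℂ) : MvPolynomial (Fin n) ℂ :=
  MvPolynomial.map (starRingEnd ℂ) P

def IsPosDefC {n : ℕ} (Λ : MvPolynomial (Fin n) ℂ →ₗ[ℂ] ℂ) : Prop :=
  ∀ P : MvPolynomial (Fin n) ℂ, 0 ≤ Λ (starC P * P)

def IsMomentC {n : ℕ} (Λ : MvPolynomial (Fin n) ℂ →ₗ[ℂ] ℂ) : Prop :=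
  ∃ μ : Measure (Fin n → ℝ),
    (∀ Q : MvPolynomial (Fin n) ℂ, Integrable (fun x => evalC Q x) μ) ∧
    (∀ Q : MvPolynomial (Fin n) ℂ, Λ Q = ∫ x, evalC Q x ∂μ)

noncomputable def vanishingIdealC {n : ℕ} (Z : Set (Fin n → ℝ)) :
    Ideal (MvPolynomial (Fin n) ℂ) where
  carrier := {P | ∀ x ∈ Z, evalC P x = 0}
  add_mem' := by
    intro a b ha hb x hx
    simp only [Set.mem_setOf_eq, evalC, map_add] at *
    rw [ha x hx, hb x hx, add_zero]
  zero_mem' := by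
    intro x hx
    simp [evalC]
  smul_mem' := by
    intro c a ha x hx
    simp only [Set.mem_setOf_eq, evalC, smul_eq_mul, map_mul] at *
    rw [ha x hx, mul_zero]

def zeroSetC {n : ℕ} (I : Ideal (MvPolynomial (Fin n) ℂ)) : Set (Fin n → ℝ) :=
  {x | ∀ P ∈ I, evalC P x = 0}

def zSetC {n : ℕ} (P : MvPolynomial (Fin n) ℂ) : Set (Fin n → ℝ) :=
  {x | evalC P x = 0}

def VanishesOnC {n : ℕ} (Λ : MvPolynomial (Fin n) ℂ →ₗ[ℂ] ℂ)
    (I : Ideal (MvPolynomial (Fin n) ℂ)) : Prop :=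
  ∀ P ∈ I, Λ P = 0

def nSetC {n : ℕ} (Λ : MvPolynomial (Fin n) ℂ →ₗ[ℂ] ℂ) : Set (MvPolynomial (Fin n) ℂ) :=
  {P | Λ (starC P * P) = 0}

def IsTypeAC {n : ℕ} (P : MvPolynomial (Fin n) ℂ) : Prop :=
  ∀ Λ : MvPolynomial (Fin n) ℂ →ₗ[ℂ] ℂ,
    IsPosDefC Λ → VanishesOnC Λ (Ideal.span {P}) → IsMomentC Λ

open Polynomial in
/-- The intermediate value property for polynomials over an ordered field. -/
def PolyIVT (K : Type*) [Field K] [LinearOrder K] : Prop :=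
  ∀ (p : K[X]) (a b : K), a < b → p.eval a * p.eval b < 0 → ∃ c, a < c ∧ c < b ∧ p.eval c = 0

namespace PolyIVT

open Polynomial

section Field

variable {K : Type*} [Field K] [LinearOrder K] [IsStrictOrderedRing K]

lemma eval_mul_eval_pos (h : PolyIVT K) {p : K[X]} {a b : K} (hab : a ≤ b)
    (hr : ∀ c, a ≤ c → c ≤ b → p.eval c ≠ 0) : 0 < p.eval a * p.eval b := by
  by_contra hn
  have hne : p.eval a * p.eval b ≠ 0 :=
    mul_ne_zero (hr a le_rfl hab) (hr b hab le_rfl)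
  have hlt : p.eval a * p.eval b < 0 := lt_of_le_of_ne (not_lt.1 hn) hne
  rcases hab.eq_or_lt with rfl | hab'
  · exact absurd hlt (not_lt.2 (mul_self_nonneg _))
  · obtain ⟨c, hac, hcb, hc⟩ := h p a b hab' hlt
    exact hr c hac.le hcb.le hc

lemma rolle_consecutive (h : PolyIVT K) {p : K[X]} (hp : p ≠ 0) {a b : K} (hab : a < b)
    (ha : p.eval a = 0) (hb : p.eval b = 0) (hr : ∀ c, a < c → c < b → p.eval c ≠ 0) :
    ∃ c, a < c ∧ c < b ∧ (derivative p).eval c = 0 := by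
  obtain ⟨u, hu, hua⟩ := exists_eq_pow_rootMultiplicity_mul_and_not_dvd p hp a
  have hu0 : u ≠ 0 := by rintro rfl; simp at hua
  obtain ⟨q, hq, hqb⟩ := exists_eq_pow_rootMultiplicity_mul_and_not_dvd u hu0 b
  have hm : rootMultiplicity a p ≠ 0 := by
    have := (rootMultiplicity_pos hp (x := a)).2 ha
    omega
  have hub : u.eval b = 0 := by
    have := hb
    rw [hu, eval_mul] at this
    refine (mul_eq_zero.1 this).resolve_left ?_
    simpa using fun h0 => absurd h0 (sub_ne_zero.2 hab.ne')
  have hn : rootMultiplicity b u ≠ 0 := by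
    have := (rootMultiplicity_pos hu0 (x := b)).2 hub
    omega
  obtain ⟨m, hm⟩ := Nat.exists_eq_succ_of_ne_zero hm
  obtain ⟨n, hn⟩ := Nat.exists_eq_succ_of_ne_zero hn
  rw [hm] at hu
  rw [hn] at hq
  rw [dvd_iff_isRoot, IsRoot.def] at hua hqb
  have hqr : ∀ c, a ≤ c → c ≤ b → q.eval c ≠ 0 := by
    intro c hac hcb hc
    have huc : u.eval c = 0 := by rw [hq, eval_mul, hc, mul_zero]
    rcases hac.eq_or_lt with rfl | hac
    · exact hua huc
    rcases hcb.eq_or_lt with rfl | hcb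
    · exact hqb hc
    · exact hr c hac hcb (by rw [hu, eval_mul, huc, mul_zero])
  have hpos := h.eval_mul_eval_pos hab.le hqr
  set r : K[X] := C ((m : K) + 1) * (X - C b) * q + C ((n : K) + 1) * (X - C a) * q +
    (X - C a) * (X - C b) * derivative q with hrdef
  have hd : derivative p = (X - C a) ^ m * (X - C b) ^ n * r := by
    rw [hu, hq, hrdef]
    simp only [derivative_mul, derivative_pow, derivative_sub, derivative_X, derivative_C,
      Nat.succ_eq_add_one, Nat.add_sub_cancel, map_add, map_natCast, map_one, Nat.cast_add,
      Nat.cast_one]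
    ring
  have hneg : r.eval a * r.eval b < 0 := by
    have e1 : r.eval a = -((m + 1) * (b - a) * q.eval a) := by simp [hrdef]; ring
    have e2 : r.eval b = (n + 1) * (b - a) * q.eval b := by simp [hrdef]
    rw [e1, e2]
    have : 0 < ((m : K) + 1) * (n + 1) * (b - a) ^ 2 * (q.eval a * q.eval b) := by
      have := sub_pos.2 hab
      positivity
    linear_combination this
  obtain ⟨c, hac, hcb, hc⟩ := h r a b hab hneg
  exact ⟨c, hac, hcb, by rw [hd, eval_mul, hc, mul_zero]⟩

lemma rolle (h : PolyIVT K) {p : K[X]} {a b : K} (hab : a < b)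
    (ha : p.eval a = 0) (hb : p.eval b = 0) :
    ∃ c, a < c ∧ c < b ∧ (derivative p).eval c = 0 := by
  by_cases hp : p = 0
  · obtain ⟨c, hc⟩ := exists_between hab
    exact ⟨c, hc.1, hc.2, by simp [hp]⟩
  obtain ⟨b', hb', hmin⟩ := Finset.exists_min_image (p.roots.toFinset.filter (a < ·)) id
    ⟨b, by simp [hp, hb, hab]⟩
  simp only [Finset.mem_filter, Multiset.mem_toFinset, mem_roots hp, IsRoot.def, id] at hb' hmin
  obtain ⟨c, hac, hcb, hc⟩ := rolle_consecutive h hp hb'.2 ha hb'.1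
    fun c hac hcb hc => absurd (hmin c ⟨hc, hac⟩) (not_le.2 hcb)
  exact ⟨c, hac, hcb.trans_le (hmin b ⟨hb, hab⟩), hc⟩

lemma exists_derivative_eq_slope (h : PolyIVT K) (p : K[X]) {a b : K} (hab : a < b) :
    ∃ c, a < c ∧ c < b ∧ p.eval b - p.eval a = (derivative p).eval c * (b - a) := by
  have hba : b - a ≠ 0 := sub_ne_zero.2 hab.ne'
  obtain ⟨c, hac, hcb, hc⟩ := h.rolle (p := p - C (p.eval a) -
    C ((p.eval b - p.eval a) / (b - a)) * (X - C a)) hab (by simp) (by simp [hba])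
  refine ⟨c, hac, hcb, ?_⟩
  simp only [derivative_sub, derivative_C, derivative_mul, derivative_X, eval_sub,
    eval_C, zero_mul, sub_zero, mul_one, zero_add] at hc
  rw [sub_eq_zero.1 hc]
  field_simp

lemma strictMonoOn_or_strictAntiOn (h : PolyIVT K) {p : K[X]} {a b : K}
    (hr : ∀ c, a < c → c < b → (derivative p).eval c ≠ 0) :
    StrictMonoOn (fun x => p.eval x) (Set.Icc a b) ∨
      StrictAntiOn (fun x => p.eval x) (Set.Icc a b) := by
  rcases lt_or_ge a b with hab | hab
  swap
  · exact .inl fun x hx y hy hxy =>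
      absurd (hx.1.trans_lt (hxy.trans_le (hy.2.trans hab))) (lt_irrefl _)
  obtain ⟨d, had, hdb⟩ := exists_between hab
  have key : ∀ c, a < c → c < b →
      0 < (derivative p).eval c * (derivative p).eval d := by
    intro c hac hcb
    rcases le_total c d with hcd | hcd
    · exact h.eval_mul_eval_pos hcd fun e h1 h2 => hr e (hac.trans_le h1) (h2.trans_lt hdb)
    · rw [mul_comm]
      exact h.eval_mul_eval_pos hcd fun e h1 h2 => hr e (had.trans_le h1) (h2.trans_lt hcb)
  rcases lt_or_gt_of_ne (hr d had hdb) with hd | hd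
  · refine .inr fun x hx y hy hxy => ?_
    obtain ⟨c, hxc, hcy, hc⟩ := h.exists_derivative_eq_slope p hxy
    have h1 := neg_of_mul_pos_left (key c (hx.1.trans_lt hxc) (hcy.trans_le hy.2)) hd.le
    exact sub_neg.1 (hc ▸ mul_neg_of_neg_of_pos h1 (sub_pos.2 hxy))
  · refine .inl fun x hx y hy hxy => ?_
    obtain ⟨c, hxc, hcy, hc⟩ := h.exists_derivative_eq_slope p hxy
    have h1 := pos_of_mul_pos_left (key c (hx.1.trans_lt hxc) (hcy.trans_le hy.2)) hd.le
    exact sub_pos.1 (hc ▸ mul_pos h1 (sub_pos.2 hxy))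

end Field

lemma real : PolyIVT ℝ := by
  intro p a b hab hneg
  have hc : ContinuousOn (fun x => p.eval x) (Set.Icc a b) := p.continuous.continuousOn
  rcases mul_neg_iff.1 hneg with ⟨h1, h2⟩ | ⟨h1, h2⟩
  · obtain ⟨c, hc, h0⟩ := intermediate_value_Ioo' hab.le hc ⟨h2, h1⟩
    exact ⟨c, hc.1, hc.2, h0⟩
  · obtain ⟨c, hc, h0⟩ := intermediate_value_Ioo hab.le hc ⟨h1, h2⟩
    exact ⟨c, hc.1, hc.2, h0⟩

lemma germ {α M : Type*} [Field M] [LinearOrder M] [IsStrictOrderedRing M]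
    (h : PolyIVT M) (U : Ultrafilter α) : PolyIVT ((U : Filter α).Germ M) := by
  intro p a b hab hneg
  have hrep : ∀ x : (U : Filter α).Germ M, ∃ f : α → M, (f : (U : Filter α).Germ M) = x :=
    fun x => Quotient.exists_rep x
  choose P hP using fun i => hrep (p.coeff i)
  obtain ⟨u, rfl⟩ := hrep a
  obtain ⟨v, rfl⟩ := hrep b
  let Q : α → M[X] := fun m => ∑ i ∈ Finset.range (p.natDegree + 1), monomial i (P i m)
  have heval : ∀ w : α → M, p.eval (w : (U : Filter α).Germ M) =
      ((fun m => (Q m).eval (w m) : α → M) : (U : Filter α).Germ M) := by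
    intro w
    have : (fun m => (Q m).eval (w m)) =
        ∑ i ∈ Finset.range (p.natDegree + 1), P i * w ^ i := by
      ext m
      simp [Q, eval_finsetSum]
    rw [this, eval_eq_sum_range]
    change _ = Filter.Germ.coeRingHom (U : Filter α) _
    rw [map_sum]
    refine Finset.sum_congr rfl fun i _ => ?_
    rw [map_mul, map_pow, ← hP i]
    rfl
  rw [heval, heval] at hneg
  have h1 : ∀ᶠ m in (U : Filter α), u m < v m := Filter.Germ.coe_lt.1 hab
  have h2 : ∀ᶠ m in (U : Filter α), (Q m).eval (u m) * (Q m).eval (v m) < 0 :=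
    Filter.Germ.coe_lt.1 hneg
  obtain ⟨w, hw⟩ := ((h1.and h2).mono fun m hm => h (Q m) _ _ hm.1 hm.2).choice
  refine ⟨w, Filter.Germ.coe_lt.2 (hw.mono fun m hm => hm.1),
    Filter.Germ.coe_lt.2 (hw.mono fun m hm => hm.2.1), ?_⟩
  rw [heval]
  exact Filter.Germ.coe_eq.2 (hw.mono fun m hm => hm.2.2)

end PolyIVT

section Cut

open Polynomial

variable {k L M : Type*} [Field k] [LinearOrder k] [Field L] [LinearOrder L] [Field M]
  [LinearOrder M] {i : k →+* L} {j : k →+* M}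

lemma exists_separating [IsStrictOrderedRing k] (i : k →+* L) (hi : StrictMono i) (x : L) (S : Finset k) :
    ∃ c, ∀ s ∈ S, (i s < x → s < c) ∧ (¬ i s < x → c < s) := by
  classical
  obtain ⟨c, h1, h2⟩ := Order.exists_between_finsets (S.filter (i · < x))
    (S.filter (¬ i · < x)) (by
      intro a ha b hb
      rw [Finset.mem_filter] at ha hb
      exact hi.lt_iff_lt.1 (ha.2.trans_le (not_lt.1 hb.2)))
  exact ⟨c, fun s hs => ⟨fun h => h1 s (by simp [hs, h]), fun h => h2 s (by simp [hs, not_lt.1 h])⟩⟩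

lemma eval₂_pos_iff_of_separating [IsStrictOrderedRing L] (hL : PolyIVT L) (hi : StrictMono i) {x : L}
    (hx : x ∉ Set.range i) {r : k[X]} (hr : r ≠ 0)
    (hroots : ∀ z, r.eval₂ i z = 0 → z ∈ Set.range i) {c : k}
    (hc : ∀ s ∈ r.roots.toFinset, (i s < x → s < c) ∧ (¬ i s < x → c < s)) :
    0 < r.eval₂ i x ↔ 0 < r.eval c := by
  have hno : ∀ z, r.eval₂ i z = 0 → ∃ s ∈ r.roots.toFinset, i s = z := by
    intro z hz
    obtain ⟨s, rfl⟩ := hroots z hz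
    refine ⟨s, ?_, rfl⟩
    rw [eval₂_at_apply, map_eq_zero] at hz
    simp [hr, hz]
  have hpos : 0 < (r.map i).eval x * (r.map i).eval (i c) := by
    rcases le_total x (i c) with hxc | hxc
    · refine hL.eval_mul_eval_pos hxc fun z h1 h2 hz => ?_
      rw [eval_map] at hz
      obtain ⟨s, hs, rfl⟩ := hno z hz
      exact absurd ((hc s hs).2 (not_lt.2 h1)) (not_lt.2 (hi.le_iff_le.1 h2))
    · rw [mul_comm]
      refine hL.eval_mul_eval_pos hxc fun z h1 h2 hz => ?_
      rw [eval_map] at hz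
      obtain ⟨s, hs, rfl⟩ := hno z hz
      have hlt : i s < x := lt_of_le_of_ne h2 fun h => hx ⟨s, h⟩
      exact absurd ((hc s hs).1 hlt) (not_lt.2 (hi.le_iff_le.1 h1))
  rw [eval_map, eval_map, eval₂_at_apply] at hpos
  rw [pos_iff_pos_of_mul_pos hpos]
  exact map_zero i ▸ hi.lt_iff_lt

variable [IsStrictOrderedRing k] [IsStrictOrderedRing L] [IsStrictOrderedRing M]

/-- If `x` and `y` fill the same cut of `k`, then a polynomial over `k` all of whose roots lie in
`k` takes the same sign at `x` and at `y`. -/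
lemma eval₂_pos_iff_of_cut (hL : PolyIVT L) (hM : PolyIVT M) (hi : StrictMono i)
    (hj : StrictMono j) {x : L} {y : M} (hx : x ∉ Set.range i) (hy : y ∉ Set.range j)
    (hcut : ∀ c, i c < x ↔ j c < y) {r : k[X]}
    (hri : r ≠ 0 → ∀ z, r.eval₂ i z = 0 → z ∈ Set.range i)
    (hrj : r ≠ 0 → ∀ z, r.eval₂ j z = 0 → z ∈ Set.range j) :
    0 < r.eval₂ i x ↔ 0 < r.eval₂ j y := by
  by_cases hr : r = 0
  · simp [hr]
  obtain ⟨c, hc⟩ := exists_separating i hi x r.roots.toFinset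
  rw [eval₂_pos_iff_of_separating hL hi hx hr (hri hr) hc,
    eval₂_pos_iff_of_separating hM hj hy hr (hrj hr)]
  simpa only [hcut] using hc

lemma exists_gt_of_eval₂_eq_zero (hi : StrictMono i) {p : k[X]} (hp : p ≠ 0) {x : L}
    (hx : p.eval₂ i x = 0) : ∃ c, x < i c := by
  by_contra! hle
  have hx1 : 1 ≤ x := by simpa using hle 1
  have hx0 : 0 < x := one_pos.trans_le hx1
  have hlead : i p.leadingCoeff ≠ 0 := by simpa using hp
  set B : k := ∑ m ∈ Finset.range p.natDegree, |p.coeff m / p.leadingCoeff| with hB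
  have hdeg : p.natDegree ≠ 0 := by
    intro h0
    rw [eq_C_of_natDegree_eq_zero h0, eval₂_C, map_eq_zero] at hx
    exact hp (by rw [eq_C_of_natDegree_eq_zero h0, hx, C_0])
  obtain ⟨d, hd⟩ := Nat.exists_eq_succ_of_ne_zero hdeg
  have hsum : x ^ (d + 1) = ∑ m ∈ Finset.range (d + 1), i (-(p.coeff m / p.leadingCoeff)) * x ^ m := by
    rw [eval₂_eq_sum_range, Finset.sum_range_succ, hd, Nat.succ_eq_add_one] at hx
    have h2 : x ^ (d + 1) * i p.leadingCoeff =
        -∑ m ∈ Finset.range (d + 1), i (p.coeff m) * x ^ m := by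
      have : p.coeff (d + 1) = p.leadingCoeff := by rw [leadingCoeff, hd]
      rw [← this]
      linear_combination hx
    rw [eq_div_of_mul_eq hlead h2, neg_div, Finset.sum_div, ← Finset.sum_neg_distrib]
    refine Finset.sum_congr rfl fun m _ => ?_
    rw [map_neg, map_div₀]
    ring
  have hle2 : x ^ (d + 1) ≤ i B * x ^ d := by
    rw [hsum, hB, map_sum, Finset.sum_mul, hd]
    refine Finset.sum_le_sum fun m hm => ?_
    have hm : m ≤ d := by simpa [Nat.lt_succ_iff] using hm
    refine (mul_le_mul_of_nonneg_right (b := i (-_)) (hi.monotone (neg_le_abs _))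
      (pow_nonneg hx0.le m)).trans ?_
    exact mul_le_mul_of_nonneg_left (pow_le_pow_right₀ hx1 hm)
      (map_zero i ▸ hi.monotone (abs_nonneg _))
  have hxB : x ≤ i B := by
    rw [pow_succ'] at hle2
    exact le_of_mul_le_mul_right hle2 (pow_pos hx0 d)
  have := hle (B + 1)
  rw [map_add, map_one] at this
  linarith

lemma exists_lt_of_eval₂_eq_zero (hi : StrictMono i) {p : k[X]} (hp : p ≠ 0) {x : L}
    (hx : p.eval₂ i x = 0) : ∃ c, i c < x := by
  obtain ⟨c, hc⟩ := exists_gt_of_eval₂_eq_zero hi (p := p.comp (-X)) (x := -x)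
    (by rwa [Ne, comp_neg_X_eq_zero_iff]) (by simpa [eval₂_comp] using hx)
  exact ⟨-c, by rw [map_neg]; linarith⟩

/-- A root in `L` of a polynomial `p` over `k` of minimal degree among those with roots outside
`k` has a counterpart in `M` with the same sign behaviour over `k`. -/
lemma exists_compatible_root (hL : PolyIVT L) (hM : PolyIVT M) (hi : StrictMono i)
    (hj : StrictMono j) {p : k[X]} (hp : p ≠ 0)
    (hri : ∀ r : k[X], r ≠ 0 → r.natDegree < p.natDegree →
      ∀ z, r.eval₂ i z = 0 → z ∈ Set.range i)
    (hrj : ∀ r : k[X], r ≠ 0 → r.natDegree < p.natDegree →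
      ∀ z, r.eval₂ j z = 0 → z ∈ Set.range j)
    {x : L} (hx : p.eval₂ i x = 0) (hxi : x ∉ Set.range i) :
    ∃ y : M, ∀ g : k[X], 0 < g.eval₂ i x ↔ 0 < g.eval₂ j y := by
  classical
  have hdeg : p.natDegree ≠ 0 := by
    intro h0
    rw [eq_C_of_natDegree_eq_zero h0, eval₂_C, map_eq_zero] at hx
    exact hp (by rw [eq_C_of_natDegree_eq_zero h0, hx, C_0])
  have hdp : derivative p ≠ 0 := fun h => hdeg (Polynomial.derivative_eq_zero.1 h)
  have hdlt : (derivative p).natDegree < p.natDegree := natDegree_derivative_lt hdeg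
  obtain ⟨lo, hlo⟩ := exists_lt_of_eval₂_eq_zero hi hp hx
  obtain ⟨up, hup⟩ := exists_gt_of_eval₂_eq_zero hi hp hx
  set S := (derivative p).roots.toFinset
  obtain ⟨a, ha, hamax⟩ := Finset.exists_max_image (insert lo (S.filter (i · < x))) id (by simp)
  obtain ⟨b, hb, hbmin⟩ := Finset.exists_min_image (insert up (S.filter (x < i ·))) id (by simp)
  have hax : i a < x := by
    rcases Finset.mem_insert.1 ha with rfl | h
    · exact hlo
    · exact (Finset.mem_filter.1 h).2
  have hxb : x < i b := by
    rcases Finset.mem_insert.1 hb with rfl | h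
    · exact hup
    · exact (Finset.mem_filter.1 h).2
  have hab : a < b := hi.lt_iff_lt.1 (hax.trans hxb)
  have hS : ∀ c, (derivative p).eval c = 0 → ¬ (a < c ∧ c < b) := by
    intro c hc ⟨h1, h2⟩
    have hcS : c ∈ S := by simp [S, hdp, hc]
    rcases lt_trichotomy (i c) x with h | h | h
    · exact absurd (hamax c (by simp [hcS, h])) (not_le.2 h1)
    · exact hxi ⟨c, h⟩
    · exact absurd (hbmin c (by simp [hcS, h])) (not_le.2 h2)
  have hmi := hL.strictMonoOn_or_strictAntiOn (p := p.map i) (a := i a) (b := i b) (by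
    intro c h1 h2 hc
    rw [derivative_map, eval_map] at hc
    obtain ⟨c, rfl⟩ := hri _ hdp hdlt c hc
    rw [eval₂_at_apply, map_eq_zero] at hc
    exact hS c hc ⟨hi.lt_iff_lt.1 h1, hi.lt_iff_lt.1 h2⟩)
  have hmj := hM.strictMonoOn_or_strictAntiOn (p := p.map j) (a := j a) (b := j b) (by
    intro c h1 h2 hc
    rw [derivative_map, eval_map] at hc
    obtain ⟨c, rfl⟩ := hrj _ hdp hdlt c hc
    rw [eval₂_at_apply, map_eq_zero] at hc
    exact hS c hc ⟨hj.lt_iff_lt.1 h1, hj.lt_iff_lt.1 h2⟩)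
  wlog hmono : StrictMonoOn (fun z => (p.map i).eval z) (Set.Icc (i a) (i b)) generalizing p
  · have hanti := hmi.resolve_left hmono
    have hS' : (derivative (-p)).roots.toFinset = S := by simp [S]
    refine this (p := -p) (neg_ne_zero.2 hp) (by simpa using hri) (by simpa using hrj)
      (by simpa using hx) (by simpa using hdeg) (by simpa using hdp) (by simpa using hdlt)
      ?_ ?_ ?_ ?_ ?_ ?_ ?_ ?_
    all_goals first
      | simpa only [hS'] using ha
      | simpa only [hS'] using hb
      | simpa only [hS'] using hamax
      | simpa only [hS'] using hbmin
      | simpa using hS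
      | skip
    · exact .inl (by simpa [Polynomial.map_neg] using hanti.neg)
    · rcases hmj with h | h
      · exact .inr (by simpa [Polynomial.map_neg] using h.neg)
      · exact .inl (by simpa [Polynomial.map_neg] using h.neg)
    · simpa [Polynomial.map_neg] using hanti.neg
  have hIi : ∀ c, a ≤ c → c ≤ b → i c ∈ Set.Icc (i a) (i b) := fun c h1 h2 =>
    ⟨hi.monotone h1, hi.monotone h2⟩
  have hIj : ∀ c, a ≤ c → c ≤ b → j c ∈ Set.Icc (j a) (j b) := fun c h1 h2 =>
    ⟨hj.monotone h1, hj.monotone h2⟩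
  have hxI : x ∈ Set.Icc (i a) (i b) := ⟨hax.le, hxb.le⟩
  have hp0 : (p.map i).eval x = 0 := by rwa [eval_map]
  have hsgn : ∀ c, a ≤ c → c ≤ b → (i c < x ↔ p.eval c < 0) := by
    intro c h1 h2
    rw [← hmono.lt_iff_lt (hIi c h1 h2) hxI]
    simp only [hp0]
    rw [eval_map, eval₂_at_apply]
    exact map_zero i ▸ hi.lt_iff_lt
  have hpa : p.eval a < 0 := (hsgn a le_rfl hab.le).1 hax
  have hpb : 0 < p.eval b := by
    have := hmono hxI (hIi b hab.le le_rfl) hxb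
    simp only [hp0] at this
    rw [eval_map, eval₂_at_apply] at this
    exact hi.lt_iff_lt.1 (by rwa [map_zero])
  have hja : (p.map j).eval (j a) < 0 := by
    rw [eval_map, eval₂_at_apply]
    exact map_zero j ▸ hj hpa
  have hjb : 0 < (p.map j).eval (j b) := by
    rw [eval_map, eval₂_at_apply]
    exact map_zero j ▸ hj hpb
  have hmonoj : StrictMonoOn (fun z => (p.map j).eval z) (Set.Icc (j a) (j b)) := by
    refine hmj.resolve_right fun h => ?_
    exact absurd (h (hIj a le_rfl hab.le) (hIj b hab.le le_rfl) (hj hab))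
      (not_lt.2 (hja.trans hjb).le)
  obtain ⟨y, hay, hyb, hy⟩ := hM (p.map j) (j a) (j b) (hj hab) (mul_neg_of_neg_of_pos hja hjb)
  have hyI : y ∈ Set.Icc (j a) (j b) := ⟨hay.le, hyb.le⟩
  have hsgnj : ∀ c, a ≤ c → c ≤ b → (j c < y ↔ p.eval c < 0) := by
    intro c h1 h2
    rw [← hmonoj.lt_iff_lt (hIj c h1 h2) hyI]
    simp only [hy]
    rw [eval_map, eval₂_at_apply]
    exact map_zero j ▸ hj.lt_iff_lt
  have hyj : y ∉ Set.range j := by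
    rintro ⟨c, rfl⟩
    rw [eval_map, eval₂_at_apply, map_eq_zero] at hy
    have hac := (hj.lt_iff_lt.1 hay).le
    have hcb := (hj.lt_iff_lt.1 hyb).le
    refine hxi ⟨c, hmono.injOn (hIi c hac hcb) hxI ?_⟩
    simp only [hp0]
    rw [eval_map, eval₂_at_apply, hy, map_zero]
  have hcut : ∀ c, i c < x ↔ j c < y := by
    intro c
    rcases lt_or_ge c a with h1 | h1
    · exact iff_of_true ((hi h1).trans hax) ((hj h1).trans hay)
    rcases lt_or_ge b c with h2 | h2
    · exact iff_of_false (hxb.trans (hi h2)).asymm (hyb.trans (hj h2)).asymm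
    · rw [hsgn c h1 h2, hsgnj c h1 h2]
  refine ⟨y, fun g => ?_⟩
  have hgi : g.eval₂ i x = (g % p).eval₂ i x := by
    conv_lhs => rw [← EuclideanDomain.div_add_mod g p]
    rw [eval₂_add, eval₂_mul, hx, zero_mul, zero_add]
  have hgj : g.eval₂ j y = (g % p).eval₂ j y := by
    conv_lhs => rw [← EuclideanDomain.div_add_mod g p]
    rw [eval₂_add, eval₂_mul, ← eval_map, hy, zero_mul, zero_add]
  have hlt : (g % p).natDegree < p.natDegree := natDegree_mod_lt g hdeg
  rw [hgi, hgj]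
  exact eval₂_pos_iff_of_cut hL hM hi hj hxi hyj hcut (fun h => hri _ h hlt)
    (fun h => hrj _ h hlt)

end Cut

section SignCoherent

open Polynomial

variable {L M : Type*} [Field L] [LinearOrder L] [Field M] [LinearOrder M]

/-- A subring of a product of ordered fields is sign coherent if the two coordinates of each of
its elements are simultaneously positive. -/
def SignCoherent (G : Subring (L × M)) : Prop := ∀ z ∈ G, 0 < z.1 ↔ 0 < z.2

lemma exists_maximal_signCoherent {G : Subring (L × M)} (hG : SignCoherent G) :
    ∃ H, G ≤ H ∧ Maximal SignCoherent H := by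
  refine zorn_le_nonempty₀ {H : Subring (L × M) | SignCoherent H} ?_ G hG
  intro c hc hchain y hy
  refine ⟨sSup c, ?_, fun z hz => le_sSup hz⟩
  intro z hz
  obtain ⟨H, hH, hzH⟩ := (Subring.mem_sSup_of_directedOn ⟨y, hy⟩ hchain.directedOn).1 hz
  exact hc hH z hzH

variable [IsStrictOrderedRing L] [IsStrictOrderedRing M]

namespace SignCoherent

lemma neg_iff {G : Subring (L × M)} (hG : SignCoherent G) {z : L × M} (hz : z ∈ G) :
    z.1 < 0 ↔ z.2 < 0 := by
  simpa using hG (-z) (neg_mem hz)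

lemma eq_zero_iff {G : Subring (L × M)} (hG : SignCoherent G) {z : L × M} (hz : z ∈ G) :
    z.1 = 0 ↔ z.2 = 0 := by
  have h1 := hG z hz
  have h2 := hG.neg_iff hz
  constructor
  · intro h
    rw [h] at h1 h2
    exact le_antisymm (not_lt.1 fun h => lt_irrefl _ (h1.2 h))
      (not_lt.1 fun h => lt_irrefl _ (h2.2 h))
  · intro h
    rw [h] at h1 h2
    exact le_antisymm (not_lt.1 fun h => lt_irrefl _ (h1.1 h))
      (not_lt.1 fun h => lt_irrefl _ (h2.1 h))

lemma inv_mem_of_maximal {G : Subring (L × M)} (hG : Maximal SignCoherent G) {z : L × M}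
    (hz : z ∈ G) (h0 : z ≠ 0) : z⁻¹ ∈ G := by
  have h1 : z.1 ≠ 0 := fun h => h0 (Prod.ext h ((hG.1.eq_zero_iff hz).1 h))
  have h2 : z.2 ≠ 0 := fun h => h1 ((hG.1.eq_zero_iff hz).2 h)
  have up : ∀ {v : L × M} {m n : ℕ}, v * z ^ m ∈ G → v * z ^ (m + n) ∈ G := by
    intro v m n h
    rw [pow_add, ← mul_assoc]
    exact mul_mem h (pow_mem hz n)
  let H : Subring (L × M) :=
    { carrier := {v | ∃ n : ℕ, v * z ^ n ∈ G}
      mul_mem' := by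
        rintro a b ⟨m, hm⟩ ⟨n, hn⟩
        refine ⟨m + n, ?_⟩
        rw [pow_add, mul_mul_mul_comm]
        exact mul_mem hm hn
      one_mem' := ⟨0, by simp⟩
      add_mem' := by
        rintro a b ⟨m, hm⟩ ⟨n, hn⟩
        refine ⟨m + n, ?_⟩
        rw [add_mul]
        exact add_mem (up hm) (add_comm n m ▸ up hn)
      zero_mem' := ⟨0, by simp⟩
      neg_mem' := by
        rintro a ⟨m, hm⟩
        exact ⟨m, by rw [neg_mul]; exact neg_mem hm⟩ }
  have hH : SignCoherent H := by
    rintro v ⟨n, hn⟩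
    have h := hG.1 _ (up (n := n) hn)
    simp only [Prod.fst_mul, Prod.snd_mul, Prod.pow_fst, Prod.pow_snd] at h
    rwa [mul_pos_iff_of_pos_right, mul_pos_iff_of_pos_right] at h
    · exact (Even.add_self n).pow_pos h2
    · exact (Even.add_self n).pow_pos h1
  refine hG.2 hH (fun v hv => ⟨0, by simpa using hv⟩) ⟨1, ?_⟩
  have : z⁻¹ * z ^ 1 = 1 := by
    rw [pow_one]
    exact Prod.ext (inv_mul_cancel₀ h1) (inv_mul_cancel₀ h2)
  rw [this]
  exact one_mem G

end SignCoherent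

lemma exists_linearOrder_strictMono {k : Type*} [Field k] (i : k →+* L) :
    ∃ (_ : LinearOrder k) (_ : IsStrictOrderedRing k), StrictMono i :=
  let _ : LinearOrder k := LinearOrder.lift' i i.injective
  ⟨inferInstance, Function.Injective.isStrictOrderedRing i (map_zero i) (map_one i) (map_add i)
    (map_mul i) Iff.rfl Iff.rfl, fun _ _ h => h⟩

/-- A maximal sign coherent subring of `L × M` is (the graph of) an ordered field embedded in both
`L` and `M`, which contains every pair that is compatible with it. -/
lemma exists_field_of_maximal_signCoherent {L M : Type} [Field L] [LinearOrder L]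
    [IsStrictOrderedRing L] [Field M] [LinearOrder M] [IsStrictOrderedRing M]
    {G : Subring (L × M)} (hG : Maximal SignCoherent G) :
    ∃ (k : Type) (_ : Field k) (_ : LinearOrder k) (_ : IsStrictOrderedRing k)
      (i : k →+* L) (j : k →+* M), StrictMono i ∧ StrictMono j ∧
      (∀ z, z ∈ G ↔ ∃ c, z = (i c, j c)) ∧
      ∀ x y, (∀ g : k[X], 0 < g.eval₂ i x ↔ 0 < g.eval₂ j y) → ∃ c, i c = x ∧ j c = y := by
  have hfield : IsField G :=
    { exists_pair_ne := ⟨0, 1, zero_ne_one⟩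
      mul_comm := mul_comm
      mul_inv_cancel := by
        rintro ⟨z, hz⟩ h0
        have h0 : z ≠ 0 := fun h => h0 (Subtype.ext h)
        have h1 : z.1 ≠ 0 := fun h => h0 (Prod.ext h ((hG.1.eq_zero_iff hz).1 h))
        have h2 : z.2 ≠ 0 := fun h => h1 ((hG.1.eq_zero_iff hz).2 h)
        exact ⟨⟨z⁻¹, SignCoherent.inv_mem_of_maximal hG hz h0⟩,
          Subtype.ext (Prod.ext (mul_inv_cancel₀ h1) (mul_inv_cancel₀ h2))⟩ }
  obtain ⟨k, _, ⟨e⟩⟩ : ∃ (k : Type) (_ : Field k), Nonempty (k ≃+* G) :=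
    ⟨G, hfield.toField, ⟨RingEquiv.refl G⟩⟩
  let ι : k →+* L × M := G.subtype.comp e.toRingHom
  let i : k →+* L := (RingHom.fst L M).comp ι
  let j : k →+* M := (RingHom.snd L M).comp ι
  obtain ⟨hlin, hord, hi⟩ := exists_linearOrder_strictMono i
  have hj : StrictMono j := by
    intro a b h
    have h' : 0 < i (b - a) := by rw [map_sub]; exact sub_pos.2 (hi h)
    have := (hG.1 _ (e (b - a)).2).1 h'
    change 0 < j (b - a) at this
    rwa [map_sub, sub_pos] at this
  refine ⟨k, inferInstance, hlin, hord, i, j, hi, hj, fun z => ?_, fun x y hxy => ?_⟩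
  · exact ⟨fun hz => ⟨e.symm ⟨z, hz⟩, by simp [i, j, ι]⟩,
      by rintro ⟨c, rfl⟩; exact (e c).2⟩
  · let φ := eval₂RingHom (i.prod j) (x, y)
    have hφ : ∀ g : k[X], φ g = (g.eval₂ i x, g.eval₂ j y) := by
      intro g
      refine Prod.ext ?_ ?_
      · change RingHom.fst L M (g.eval₂ (i.prod j) (x, y)) = _
        rw [hom_eval₂]
        rfl
      · change RingHom.snd L M (g.eval₂ (i.prod j) (x, y)) = _
        rw [hom_eval₂]
        rfl
    have hH : SignCoherent φ.range := by
      rintro _ ⟨g, rfl⟩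
      rw [hφ]
      exact hxy g
    have hGH : G ≤ φ.range := fun z hz =>
      ⟨C (e.symm ⟨z, hz⟩), by rw [hφ, eval₂_C, eval₂_C]; simp [i, j, ι]⟩
    have hmem : (x, y) ∈ G := hG.2 hH hGH ⟨X, by rw [hφ, eval₂_X, eval₂_X]⟩
    exact ⟨e.symm ⟨(x, y), hmem⟩, by simp [i, ι], by simp [j, ι]⟩

lemma mem_range_of_compatible_closed {k : Type*} [Field k] [LinearOrder k] [IsStrictOrderedRing k]
    (hL : PolyIVT L) (hM : PolyIVT M) {i : k →+* L} {j : k →+* M} (hi : StrictMono i)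
    (hj : StrictMono j)
    (hmax : ∀ x y, (∀ g : k[X], 0 < g.eval₂ i x ↔ 0 < g.eval₂ j y) → ∃ c, i c = x ∧ j c = y)
    {r : k[X]} (hr : r ≠ 0) :
    (∀ z, r.eval₂ i z = 0 → z ∈ Set.range i) ∧ (∀ z, r.eval₂ j z = 0 → z ∈ Set.range j) := by
  induction hn : r.natDegree using Nat.strong_induction_on generalizing r with
  | _ n ih =>
    subst hn
    constructor
    · intro z hz
      by_contra hzi
      obtain ⟨y, hy⟩ := exists_compatible_root hL hM hi hj hr (fun p hp hlt => (ih _ hlt hp rfl).1)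
        (fun p hp hlt => (ih _ hlt hp rfl).2) hz hzi
      obtain ⟨c, hc, -⟩ := hmax z y hy
      exact hzi ⟨c, hc⟩
    · intro z hz
      by_contra hzj
      obtain ⟨y, hy⟩ := exists_compatible_root hM hL hj hi hr (fun p hp hlt => (ih _ hlt hp rfl).2)
        (fun p hp hlt => (ih _ hlt hp rfl).1) hz hzj
      obtain ⟨c, -, hc⟩ := hmax y z fun g => (hy g).symm
      exact hzj ⟨c, hc⟩

end SignCoherent

section Specialization

/-- A homomorphism from `ℝ` to `M` reflects points if every system consisting of a polynomial
equation and a polynomial inequation over `ℝ` that is solvable in `M` is solvable in `ℝ`. -/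
def ReflectsRealPoints (σ : Type*) {M : Type*} [CommRing M] (ι : ℝ →+* M) : Prop :=
  ∀ (g f : MvPolynomial σ ℝ) (x : σ → M), g.eval₂ ι x = 0 → f.eval₂ ι x ≠ 0 →
    ∃ a : σ → ℝ, MvPolynomial.eval a g = 0 ∧ MvPolynomial.eval a f ≠ 0

/-- The diagonal embedding of a ring in its germs. -/
def germDiag {α : Type*} (M : Type*) [CommRing M] (l : Filter α) : M →+* l.Germ M :=
  (Filter.Germ.coeRingHom l).comp (Pi.constRingHom α M)

lemma exists_germ_rep {α M : Type*} {l : Filter α} (x : l.Germ M) :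
    ∃ f : α → M, (f : l.Germ M) = x :=
  Quotient.exists_rep x

lemma ReflectsRealPoints.germ {σ α M : Type*} [Field M] {ι : ℝ →+* M}
    (h : ReflectsRealPoints σ ι) (U : Ultrafilter α) :
    ReflectsRealPoints σ ((germDiag M (U : Filter α)).comp ι) := by
  intro g f x hg hf
  choose u hu using fun t => exists_germ_rep (x t)
  have key : ∀ p : MvPolynomial σ ℝ, p.eval₂ ((germDiag M (U : Filter α)).comp ι) x =
      ((fun m => p.eval₂ ι (fun t => u t m) : α → M) : (U : Filter α).Germ M) := by
    intro p
    have h1 : (fun m => p.eval₂ ι (fun t => u t m)) =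
        p.eval₂ ((Pi.constRingHom α M).comp ι) u := by
      funext m
      exact (MvPolynomial.eval₂_comp_left (Pi.evalRingHom (fun _ => M) m)
        ((Pi.constRingHom α M).comp ι) u p).symm
    have hx : x = Filter.Germ.coeRingHom (U : Filter α) ∘ u := funext fun t => (hu t).symm
    have h2 : ∀ v : α → M, (v : (U : Filter α).Germ M) = Filter.Germ.coeRingHom (U : Filter α) v :=
      fun _ => rfl
    have h3 : (germDiag M (U : Filter α)).comp ι = (Filter.Germ.coeRingHom (U : Filter α)).comp
      ((Pi.constRingHom α M).comp ι) := rfl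
    rw [h1, h2, h3, hx, MvPolynomial.eval₂_comp_left]
  rw [key] at hg hf
  have hg' : ∀ᶠ m in (U : Filter α), g.eval₂ ι (fun t => u t m) = 0 := Filter.Germ.coe_eq.1 hg
  have hf' : ∀ᶠ m in (U : Filter α), f.eval₂ ι (fun t => u t m) ≠ 0 :=
    Ultrafilter.eventually_not.2 fun h0 => hf (Filter.Germ.coe_eq.2 h0)
  obtain ⟨m, hm⟩ := (hg'.and hf').exists
  exact h g f _ hm.1 hm.2

open Polynomial in
lemma exists_germ_compatible {k L M : Type*} [Field k] [LinearOrder k] [IsStrictOrderedRing k]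
    [Field L] [LinearOrder L] [IsStrictOrderedRing L] [Field M] [LinearOrder M]
    [IsStrictOrderedRing M] (hL : PolyIVT L) (hM : PolyIVT M) {i : k →+* L} {j : k →+* M}
    (hi : StrictMono i) (hj : StrictMono j)
    (hri : ∀ r : k[X], r ≠ 0 → ∀ z, r.eval₂ i z = 0 → z ∈ Set.range i)
    (hrj : ∀ r : k[X], r ≠ 0 → ∀ z, r.eval₂ j z = 0 → z ∈ Set.range j)
    {x : L} (hx : x ∉ Set.range i) :
    ∃ (U : Ultrafilter (Finset k)) (y : (U : Filter (Finset k)).Germ M), ∀ g : k[X],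
      0 < g.eval₂ i x ↔ 0 < g.eval₂ ((germDiag M (U : Filter (Finset k))).comp j) y := by
  choose c hc using exists_separating i hi x
  let U : Ultrafilter (Finset k) := Ultrafilter.of Filter.atTop
  have hU : ∀ s : k, ∀ᶠ F in (U : Filter (Finset k)), s ∈ F := fun s =>
    (Ultrafilter.of_le Filter.atTop) ((Filter.eventually_ge_atTop {s}).mono fun F hF =>
      Finset.singleton_subset_iff.1 hF)
  let e := germDiag M (U : Filter (Finset k))
  let y : (U : Filter (Finset k)).Germ M := ((fun F => j (c F) : Finset k → M) :)
  have hej : StrictMono (e.comp j) := fun a b hab =>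
    Filter.Germ.coe_lt.2 (Filter.Eventually.of_forall fun _ => hj hab)
  have hlt : ∀ s, i s < x → (e.comp j) s < y := fun s hs =>
    Filter.Germ.coe_lt.2 ((hU s).mono fun F hF => hj ((hc F s hF).1 hs))
  have hgt : ∀ s, ¬ i s < x → y < (e.comp j) s := fun s hs =>
    Filter.Germ.coe_lt.2 ((hU s).mono fun F hF => hj ((hc F s hF).2 hs))
  refine ⟨U, y, fun g => eval₂_pos_iff_of_cut hL (hM.germ U) hi hej hx ?_ ?_ (hri g) ?_⟩
  · rintro ⟨s, hs⟩
    by_cases h : i s < x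
    · exact (hlt s h).ne hs
    · exact (hgt s h).ne' hs
  · intro s
    refine ⟨hlt s, fun h => ?_⟩
    by_contra h'
    exact (hgt s h').asymm h
  · intro hg z hz
    obtain ⟨u, rfl⟩ := exists_germ_rep z
    have h1 : g.eval₂ (e.comp j) (u : (U : Filter (Finset k)).Germ M) =
        ((fun F => g.eval₂ j (u F) : Finset k → M) : (U : Filter (Finset k)).Germ M) := by
      have h2 : (fun F => g.eval₂ j (u F)) = g.eval₂ ((Pi.constRingHom (Finset k) M).comp j) u := by
        ext F
        change _ = Pi.evalRingHom (fun _ => M) F _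
        rw [hom_eval₂]
        rfl
      rw [h2]
      change _ = Filter.Germ.coeRingHom (U : Filter (Finset k)) _
      rw [hom_eval₂]
      rfl
    rw [h1] at hz
    have hz' : ∀ᶠ F in (U : Filter (Finset k)), g.eval₂ j (u F) = 0 := Filter.Germ.coe_eq.1 hz
    have hz2 : ∀ᶠ F in (U : Filter (Finset k)), ∃ s ∈ (g.roots.toFinset : Set k), j s = u F := by
      refine hz'.mono fun F hF => ?_
      obtain ⟨s, hs⟩ := hrj g hg _ hF
      refine ⟨s, ?_, hs⟩
      rw [← hs, eval₂_at_apply, map_eq_zero] at hF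
      simp [hg, hF]
    obtain ⟨s, -, hs⟩ := (Ultrafilter.eventually_exists_mem_iff (Finset.finite_toSet _)).1 hz2
    exact ⟨s, Filter.Germ.coe_eq.2 hs⟩

lemma exists_signCoherent_containing {L σ : Type} [Field L] [LinearOrder L] [IsStrictOrderedRing L]
    (hL : PolyIVT L) (ψ : ℝ →+* L) (x : σ → L) (S : Finset σ) :
    ∃ (M : Type) (_ : Field M) (_ : LinearOrder M) (_ : IsStrictOrderedRing M) (ι : ℝ →+* M),
      PolyIVT M ∧ ReflectsRealPoints σ ι ∧ ∃ G : Subring (L × M), SignCoherent G ∧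
        (∀ r, (ψ r, ι r) ∈ G) ∧ ∀ t ∈ S, ∃ y, (x t, y) ∈ G := by
  classical
  induction S using Finset.induction_on with
  | empty =>
    refine ⟨ℝ, inferInstance, inferInstance, inferInstance, RingHom.id ℝ, PolyIVT.real,
      fun g f a hg hf => ⟨a, hg, hf⟩, (ψ.prod (RingHom.id ℝ)).range, ?_, fun r => ⟨r, rfl⟩,
      by simp⟩
    rintro _ ⟨r, rfl⟩
    have hψ : StrictMono ψ := by
      intro a b hab
      rw [← sub_pos, ← map_sub, ← Real.mul_self_sqrt (sub_pos.2 hab).le, map_mul]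
      exact mul_self_pos.2 ((map_ne_zero ψ).2 (Real.sqrt_ne_zero'.2 (sub_pos.2 hab)))
    change 0 < ψ r ↔ 0 < r
    exact map_zero ψ ▸ hψ.lt_iff_lt
  | insert t S ht ih =>
    obtain ⟨M, _, _, _, ι, hM, hι, G, hG, hGr, hGS⟩ := ih
    obtain ⟨H, hGH, hH⟩ := exists_maximal_signCoherent hG
    by_cases hxt : ∃ y, (x t, y) ∈ H
    · refine ⟨M, inferInstance, inferInstance, inferInstance, ι, hM, hι, H, hH.1,
        fun r => hGH (hGr r), fun s hs => ?_⟩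
      rcases Finset.mem_insert.1 hs with rfl | hs
      · exact hxt
      · exact (hGS s hs).imp fun y hy => hGH hy
    obtain ⟨k, _, _, _, i, j, hi, hj, hmem, hmax⟩ := exists_field_of_maximal_signCoherent hH
    have hx : x t ∉ Set.range i := by
      rintro ⟨c, hc⟩
      exact hxt ⟨j c, (hmem _).2 ⟨c, by rw [hc]⟩⟩
    obtain ⟨U, y, hy⟩ := exists_germ_compatible hL hM hi hj
      (fun r hr => (mem_range_of_compatible_closed hL hM hi hj hmax hr).1)
      (fun r hr => (mem_range_of_compatible_closed hL hM hi hj hmax hr).2) hx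
    set e := germDiag M (U : Filter (Finset k))
    let φ := Polynomial.eval₂RingHom (i.prod (e.comp j)) (x t, y)
    have hφ : ∀ g, φ g = (g.eval₂ i (x t), g.eval₂ (e.comp j) y) := by
      intro g
      refine Prod.ext ?_ ?_
      · change RingHom.fst L _ (g.eval₂ (i.prod (e.comp j)) (x t, y)) = _
        rw [Polynomial.hom_eval₂]
        rfl
      · change RingHom.snd L _ (g.eval₂ (i.prod (e.comp j)) (x t, y)) = _
        rw [Polynomial.hom_eval₂]
        rfl
    have hmap : ∀ z ∈ G, (z.1, e z.2) ∈ φ.range := by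
      intro z hz
      obtain ⟨c, rfl⟩ := (hmem z).1 (hGH hz)
      exact ⟨Polynomial.C c, by rw [hφ, Polynomial.eval₂_C, Polynomial.eval₂_C]; rfl⟩
    refine ⟨(U : Filter (Finset k)).Germ M, inferInstance, inferInstance, inferInstance,
      e.comp ι, hM.germ U, hι.germ U, φ.range, ?_, fun r => hmap _ (hGr r), fun s hs => ?_⟩
    · rintro _ ⟨g, rfl⟩
      rw [hφ]
      exact hy g
    · rcases Finset.mem_insert.1 hs with rfl | hs
      · exact ⟨y, Polynomial.X, by rw [hφ, Polynomial.eval₂_X, Polynomial.eval₂_X]⟩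
      · obtain ⟨z, hz⟩ := hGS s hs
        exact ⟨e z, hmap _ hz⟩

/-- The Artin–Lang theorem: a polynomial system over `ℝ` solvable in an ordered extension field with
the intermediate value property is solvable in `ℝ`. -/
theorem reflectsRealPoints {L σ : Type} [Finite σ] [Field L] [LinearOrder L]
    [IsStrictOrderedRing L] (hL : PolyIVT L) (ψ : ℝ →+* L) : ReflectsRealPoints σ ψ := by
  intro g f x hg hf
  have := Fintype.ofFinite σ
  obtain ⟨M, _, _, _, ι, hM, hι, G, hG, hGr, hGx⟩ :=
    exists_signCoherent_containing hL ψ x Finset.univ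
  choose y hy using fun t => hGx t (Finset.mem_univ t)
  have hmem : ∀ p : MvPolynomial σ ℝ, (p.eval₂ ψ x, p.eval₂ ι y) ∈ G := by
    intro p
    induction p using MvPolynomial.induction_on with
    | C a => simpa using hGr a
    | add p q hp hq => simpa using add_mem hp hq
    | mul_X p t hp => simpa using mul_mem hp (hy t)
  exact hι g f y ((hG.eq_zero_iff (hmem g)).1 hg)
    fun h => hf ((hG.eq_zero_iff (hmem f)).2 h)

end Specialization

section RealClosure

open Polynomial

lemma IsSumSq.map_ringHom {R S : Type*} [CommSemiring R] [CommSemiring S] (f : R →+* S) {a : R}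
    (h : IsSumSq a) : IsSumSq (f a) := by
  induction h with
  | zero => simp
  | sq_add a _ ih => rw [map_add, map_mul]; exact .sq_add _ ih

/-- The additive monoid of all sums of squares of elements of `S`. -/
def sumSqOf {Ω : Type*} [CommRing Ω] (S : Set Ω) : AddSubmonoid Ω :=
  AddSubmonoid.closure ((fun y => y * y) '' S)

lemma sumSqOf_mono {Ω : Type*} [CommRing Ω] {S T : Set Ω} (h : S ⊆ T) :
    sumSqOf S ≤ sumSqOf T :=
  AddSubmonoid.closure_mono (Set.image_mono h)

lemma mem_sumSqOf_range {L Ω : Type*} [CommRing L] [CommRing Ω] (f : L →+* Ω) {x : Ω} :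
    x ∈ sumSqOf (Set.range f) ↔ ∃ s, IsSumSq s ∧ f s = x := by
  constructor
  · intro h
    induction h using AddSubmonoid.closure_induction with
    | mem x hx =>
      obtain ⟨_, ⟨y, rfl⟩, rfl⟩ := hx
      exact ⟨y * y, .mul_self y, map_mul ..⟩
    | zero => exact ⟨0, .zero, map_zero f⟩
    | add x y _ _ hx hy =>
      obtain ⟨s, hs, rfl⟩ := hx
      obtain ⟨t, ht, rfl⟩ := hy
      exact ⟨s + t, hs.add ht, map_add ..⟩
  · rintro ⟨s, hs, rfl⟩
    induction hs with
    | zero => simp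
    | sq_add a _ ih =>
      rw [map_add, map_mul]
      exact add_mem (AddSubmonoid.subset_closure ⟨f a, ⟨a, rfl⟩, rfl⟩) ih

lemma exists_mem_sumSqOf_of_directed {Ω ι : Type*} [CommRing Ω] [Nonempty ι] (S : ι → Set Ω)
    (hS : Directed (· ⊆ ·) S) {x : Ω} (hx : x ∈ sumSqOf (⋃ i, S i)) : ∃ i, x ∈ sumSqOf (S i) := by
  induction hx using AddSubmonoid.closure_induction with
  | mem x hx =>
    obtain ⟨y, hy, rfl⟩ := hx
    obtain ⟨i, hi⟩ := Set.mem_iUnion.1 hy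
    exact ⟨i, AddSubmonoid.subset_closure ⟨y, hi, rfl⟩⟩
  | zero => exact ⟨Classical.arbitrary ι, zero_mem _⟩
  | add x y _ _ hx hy =>
    obtain ⟨i, hi⟩ := hx
    obtain ⟨j, hj⟩ := hy
    obtain ⟨k, hik, hjk⟩ := hS i j
    exact ⟨k, add_mem (sumSqOf_mono hik hi) (sumSqOf_mono hjk hj)⟩

/-- A subfield `L` of `Ω` is maximal among those in which `-1` is not a sum of squares. -/
structure IsMaximalSemireal (L Ω : Type*) [Field L] [Field Ω] [Algebra L Ω] : Prop where
  not_isSumSq : ¬ IsSumSq (-1 : L)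
  neg_one_mem : ∀ θ : Ω, θ ∉ Set.range (algebraMap L Ω) →
    (-1 : Ω) ∈ sumSqOf (IntermediateField.adjoin L {θ} : Set Ω)

lemma exists_isMaximalSemireal {F : Type*} [Field F] (hF : ¬ IsSumSq (-1 : F)) :
    ∃ L : IntermediateField F (AlgebraicClosure F), IsMaximalSemireal L (AlgebraicClosure F) := by
  have hbot : (⊥ : IntermediateField F (AlgebraicClosure F)) ∈
      {K : IntermediateField F (AlgebraicClosure F) |
        (-1 : AlgebraicClosure F) ∉ sumSqOf (K : Set (AlgebraicClosure F))} := by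
    intro h
    rw [IntermediateField.coe_bot, mem_sumSqOf_range] at h
    obtain ⟨s, hs, h⟩ := h
    rw [← map_one (algebraMap F (AlgebraicClosure F)), ← map_neg] at h
    exact hF ((algebraMap F (AlgebraicClosure F)).injective h ▸ hs)
  obtain ⟨L, -, hL⟩ := zorn_le_nonempty₀ _ (fun c hc hchain y hy => by
    have : Nonempty c := ⟨⟨y, hy⟩⟩
    have hdir : Directed (· ≤ ·) (Subtype.val : c → _) := hchain.directed
    refine ⟨⨆ i : c, i.1, fun h => ?_, fun z hz => le_iSup (fun i : c => i.1) ⟨z, hz⟩⟩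
    rw [IntermediateField.coe_iSup_of_directed hdir] at h
    obtain ⟨i, hi⟩ := exists_mem_sumSqOf_of_directed _ (fun i j => hdir i j) h
    exact hc i.2 hi) ⊥ hbot
  refine ⟨L, fun h => hL.1 ?_, fun θ hθ => ?_⟩
  · have := (mem_sumSqOf_range (algebraMap L (AlgebraicClosure F))).2 ⟨_, h, rfl⟩
    rw [map_neg, map_one] at this
    refine sumSqOf_mono ?_ this
    rintro _ ⟨y, rfl⟩
    exact y.2
  · by_contra h
    let K := (IntermediateField.adjoin L {θ}).restrictScalars F
    have hK : K ≤ L := hL.2 (y := K) h fun x hx =>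
      (IntermediateField.adjoin L {θ}).algebraMap_mem ⟨x, hx⟩
    exact hθ ⟨⟨θ, hK (IntermediateField.mem_adjoin_simple_self L θ)⟩, rfl⟩

lemma exists_aeval_eq_of_mem_adjoin {L Ω : Type*} [Field L] [Field Ω] [Algebra L Ω] {θ y : Ω}
    {m : L[X]} (hm : m.Monic) (hm1 : m ≠ 1) (hθ : aeval θ m = 0)
    (hy : y ∈ IntermediateField.adjoin L {θ}) :
    ∃ q : L[X], q.natDegree < m.natDegree ∧ aeval θ q = y := by
  have halg : IsAlgebraic L θ := ⟨m, hm.ne_zero, hθ⟩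
  rw [← IntermediateField.mem_toSubalgebra,
    IntermediateField.adjoin_simple_toSubalgebra_of_isAlgebraic halg,
    Algebra.adjoin_singleton_eq_range_aeval] at hy
  obtain ⟨q, rfl⟩ := hy
  refine ⟨q %ₘ m, natDegree_modByMonic_lt q hm hm1, ?_⟩
  conv_rhs => rw [← modByMonic_add_div q m]
  simp [hθ]

namespace IsMaximalSemireal

variable {L Ω : Type*} [Field L] [Field Ω] [Algebra L Ω]

lemma isSumSq_or_isSumSq_neg [IsAlgClosed Ω] (h : IsMaximalSemireal L Ω) (a : L) :
    IsSumSq a ∨ IsSumSq (-a) := by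
  obtain ⟨θ, hθ⟩ := IsAlgClosed.exists_pow_nat_eq (algebraMap L Ω (-a)) (n := 2) (by norm_num)
  have hinj := (algebraMap L Ω).injective
  by_cases hr : θ ∈ Set.range (algebraMap L Ω)
  · obtain ⟨t, rfl⟩ := hr
    rw [← map_pow] at hθ
    exact Or.inr (hinj hθ ▸ (IsSquare.isSumSq ⟨t, sq t⟩))
  left
  have hm : (X ^ 2 + C a : L[X]).Monic := monic_X_pow_add_C a (by norm_num)
  have hd : (X ^ 2 + C a : L[X]).natDegree = 2 := natDegree_X_pow_add_C
  have hlin : ∀ y ∈ IntermediateField.adjoin L {θ}, ∃ b c : L,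
      y = algebraMap L Ω b + algebraMap L Ω c * θ := by
    intro y hy
    obtain ⟨q, hq, rfl⟩ := exists_aeval_eq_of_mem_adjoin hm
      (fun h1 => by rw [h1, natDegree_one] at hd; exact absurd hd (by norm_num))
      (by simp [hθ]) hy
    obtain ⟨c, b, rfl⟩ := exists_eq_X_add_C_of_natDegree_le_one (p := q) (by omega)
    exact ⟨b, c, by simp [add_comm]⟩
  have hform : ∀ x ∈ sumSqOf (IntermediateField.adjoin L {θ} : Set Ω), ∃ B D E : L,
      IsSumSq B ∧ IsSumSq D ∧ x = algebraMap L Ω (B - a * D) + algebraMap L Ω E * θ := by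
    intro x hx
    induction hx using AddSubmonoid.closure_induction with
    | mem x hx =>
      obtain ⟨y, hy, rfl⟩ := hx
      obtain ⟨b, c, rfl⟩ := hlin y hy
      refine ⟨b * b, c * c, 2 * b * c, .mul_self b, .mul_self c, ?_⟩
      simp only [map_sub, map_mul, map_neg, map_ofNat] at hθ ⊢
      linear_combination (algebraMap L Ω c) ^ 2 * hθ
    | zero => exact ⟨0, 0, 0, .zero, .zero, by simp⟩
    | add x y _ _ hx hy =>
      obtain ⟨B, D, E, hB, hD, rfl⟩ := hx
      obtain ⟨B', D', E', hB', hD', rfl⟩ := hy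
      refine ⟨B + B', D + D', E + E', hB.add hB', hD.add hD', ?_⟩
      simp only [map_sub, map_mul, map_add]
      ring
  obtain ⟨B, D, E, hB, hD, hE⟩ := hform _ (h.neg_one_mem θ hr)
  have hE0 : E = 0 := by
    by_contra hne
    refine hr ⟨(-1 - (B - a * D)) / E, ?_⟩
    have hne' : algebraMap L Ω E ≠ 0 := by simpa using hne
    rw [map_div₀, div_eq_iff hne', map_sub, map_neg, map_one]
    linear_combination hE
  have h1 : -1 = B - a * D := by
    apply hinj
    rw [map_neg, map_one, hE, hE0]
    simp
  have hD0 : D ≠ 0 := by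
    rintro rfl
    rw [mul_zero, sub_zero] at h1
    exact h.not_isSumSq (h1 ▸ hB)
  have ha : a = (1 + B) * D * (D⁻¹ * D⁻¹) := by
    field_simp
    linear_combination h1
  rw [ha]
  exact ((IsSumSq.one.add hB).mul hD).mul (.mul_self _)

lemma eq_zero_of_isSumSq (h : IsMaximalSemireal L Ω) {a : L} (ha : IsSumSq a)
    (hn : IsSumSq (-a)) : a = 0 := by
  by_contra h0
  refine h.not_isSumSq ?_
  have : (-1 : L) = a * -a * (a⁻¹ * a⁻¹) := by field_simp
  rw [this]
  exact (ha.mul hn).mul (.mul_self _)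

lemma exists_linearOrder [IsAlgClosed Ω] (h : IsMaximalSemireal L Ω) :
    ∃ _ : LinearOrder L, IsStrictOrderedRing L := by
  classical
  let P : RingCone L :=
    { Subsemiring.sumSq L with
      eq_zero_of_mem_of_neg_mem' := fun {a} ha hn =>
        h.eq_zero_of_isSumSq (Subsemiring.mem_sumSq.1 ha) (Subsemiring.mem_sumSq.1 hn) }
  have hP : ∀ a, a ∈ P ↔ IsSumSq a := fun a => Subsemiring.mem_sumSq
  have : HasMemOrNegMem P := ⟨fun a => by simpa only [hP] using h.isSumSq_or_isSumSq_neg a⟩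
  let _ := LinearOrder.mkOfAddGroupCone P
  have : IsOrderedRing L := IsOrderedRing.mkOfCone P
  exact ⟨inferInstance, IsOrderedRing.toIsStrictOrderedRing L⟩

lemma polyIVT [IsAlgClosed Ω] [LinearOrder L] [IsStrictOrderedRing L]
    (h : IsMaximalSemireal L Ω) : PolyIVT L := by
  have key : ∀ (d : ℕ) (p : L[X]), p.natDegree = d → ∀ a b : L, a < b →
      p.eval a * p.eval b < 0 → ∃ c, a < c ∧ c < b ∧ p.eval c = 0 := by
    intro d
    induction d using Nat.strong_induction_on with
    | _ d ih =>
    intro p hpd a b hab hp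
    have hp0 : p ≠ 0 := by rintro rfl; simp at hp
    have hpu : ¬ IsUnit p := by
      intro hu
      rw [isUnit_iff] at hu
      obtain ⟨c, -, rfl⟩ := hu
      rw [eval_C, eval_C] at hp
      exact absurd hp (not_lt.2 (mul_self_nonneg c))
    by_cases hirr : Irreducible p
    · obtain ⟨θ, hθ⟩ := IsAlgClosed.exists_aeval_eq_zero Ω p
        (fun h0 => hpu (isUnit_iff_degree_eq_zero.2 h0))
      by_cases hr : θ ∈ Set.range (algebraMap L Ω)
      · obtain ⟨l, rfl⟩ := hr
        have hl : p.eval l = 0 := by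
          rw [aeval_algebraMap_apply, coe_aeval_eq_eval] at hθ
          exact (algebraMap L Ω).injective (hθ.trans (map_zero _).symm)
        obtain ⟨q, rfl⟩ := dvd_iff_isRoot.2 hl
        obtain ⟨c, -, rfl⟩ := isUnit_iff.1
          ((hirr.isUnit_or_isUnit rfl).resolve_left (not_isUnit_X_sub_C l))
        simp only [eval_mul, eval_sub, eval_X, eval_C] at hp
        refine ⟨l, ?_, ?_, hl⟩
        · by_contra hla
          nlinarith [mul_nonneg (mul_nonneg (sub_nonneg.2 (not_lt.1 hla))
            (sub_nonneg.2 ((not_lt.1 hla).trans hab.le))) (mul_self_nonneg c)]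
        · by_contra hlb
          nlinarith [mul_nonneg (mul_nonneg (sub_nonneg.2 (not_lt.1 hlb))
            (sub_nonneg.2 (hab.le.trans (not_lt.1 hlb)))) (mul_self_nonneg c)]
      · have halg : IsAlgebraic L θ := ⟨p, hp0, hθ⟩
        have hmin := minpoly.eq_of_irreducible hirr hθ
        have hdeg : (minpoly L θ).natDegree = d := by
          rw [← hmin, natDegree_mul_C (inv_ne_zero (leadingCoeff_ne_zero.2 hp0)), hpd]
        have hd0 : 0 < d := hdeg ▸ minpoly.natDegree_pos halg.isIntegral
        have hform : ∀ x ∈ sumSqOf (IntermediateField.adjoin L {θ} : Set Ω), ∃ s : L[X],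
            IsSumSq s ∧ s.natDegree ≤ 2 * (d - 1) ∧ aeval θ s = x := by
          intro x hx
          induction hx using AddSubmonoid.closure_induction with
          | mem x hx =>
            obtain ⟨y, hy, rfl⟩ := hx
            obtain ⟨q, hq, rfl⟩ := exists_aeval_eq_of_mem_adjoin
              (minpoly.monic halg.isIntegral) (minpoly.ne_one L θ) (minpoly.aeval L θ) hy
            refine ⟨q * q, .mul_self q, natDegree_mul_le.trans (by omega), map_mul ..⟩
          | zero => exact ⟨0, .zero, by simp, map_zero _⟩
          | add x y _ _ hx hy =>
            obtain ⟨s, hs, hsd, rfl⟩ := hx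
            obtain ⟨t, ht, htd, rfl⟩ := hy
            exact ⟨s + t, hs.add ht, (natDegree_add_le s t).trans (max_le hsd htd), map_add ..⟩
        obtain ⟨s, hs, hsd, hsθ⟩ := hform _ (h.neg_one_mem θ hr)
        have hpos : ∀ c, 0 < (1 + s).eval c := fun c => by
          rw [eval_add, eval_one]
          exact add_pos_of_pos_of_nonneg one_pos (hs.map_ringHom (evalRingHom c)).nonneg
        have hdvd : p ∣ 1 + s := (Dvd.intro _ hmin).trans
          (minpoly.dvd L θ (by rw [map_add, map_one, hsθ, add_neg_cancel]))
        obtain ⟨q, hq⟩ := hdvd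
        have hq0 : q ≠ 0 := by
          rintro rfl
          have := hpos a
          rw [hq] at this
          simp at this
        have hqd : q.natDegree < d := by
          have h1 : (1 + s).natDegree ≤ 2 * (d - 1) :=
            (natDegree_add_le 1 s).trans (max_le (by simp) hsd)
          rw [hq, natDegree_mul hp0 hq0, hpd] at h1
          omega
        have hprod : ∀ c, 0 < p.eval c * q.eval c := fun c => by
          rw [← eval_mul, ← hq]; exact hpos c
        obtain ⟨c, -, -, hc⟩ := ih _ hqd q rfl a b hab (by
          by_contra hn
          have := mul_pos (hprod a) (hprod b)
          nlinarith [mul_nonneg (neg_nonneg.2 hp.le) (not_lt.1 hn)])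
        have := hprod c
        rw [hc, mul_zero] at this
        exact absurd this (lt_irrefl 0)
    · rw [irreducible_iff] at hirr
      push Not at hirr
      obtain ⟨u, v, rfl, hu, hv⟩ := hirr hpu
      have hu0 : u ≠ 0 := left_ne_zero_of_mul hp0
      have hv0 : v ≠ 0 := right_ne_zero_of_mul hp0
      have hud : 0 < u.natDegree :=
        natDegree_pos_iff_degree_pos.2 (degree_pos_of_ne_zero_of_nonunit hu0 hu)
      have hvd : 0 < v.natDegree :=
        natDegree_pos_iff_degree_pos.2 (degree_pos_of_ne_zero_of_nonunit hv0 hv)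
      rw [natDegree_mul hu0 hv0] at hpd
      rw [eval_mul, eval_mul, mul_mul_mul_comm] at hp
      rcases mul_neg_iff.1 hp with ⟨-, h1⟩ | ⟨h1, -⟩
      · obtain ⟨c, hac, hcb, hc⟩ := ih _ (by omega) v rfl a b hab h1
        exact ⟨c, hac, hcb, by rw [eval_mul, hc, mul_zero]⟩
      · obtain ⟨c, hac, hcb, hc⟩ := ih _ (by omega) u rfl a b hab h1
        exact ⟨c, hac, hcb, by rw [eval_mul, hc, zero_mul]⟩
  exact fun p => key _ p rfl

end IsMaximalSemireal

lemma exists_polyIVT_extension {F : Type*} [Field F] (hF : ¬ IsSumSq (-1 : F)) :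
    ∃ (L : IntermediateField F (AlgebraicClosure F)) (_ : LinearOrder L)
      (_ : IsStrictOrderedRing L), PolyIVT L := by
  obtain ⟨L, hL⟩ := exists_isMaximalSemireal hF
  obtain ⟨o, ho⟩ := hL.exists_linearOrder
  exact ⟨L, o, ho, hL.polyIVT⟩

end RealClosure

section PositiveFunctional

section NullIdeal

variable {A : Type*} [CommRing A] [Algebra ℝ A] {lam : A →ₗ[ℝ] ℝ}

lemma map_mul_eq_zero_of_map_mul_self (h : ∀ p, 0 ≤ lam (p * p)) {p : A}
    (hp : lam (p * p) = 0) (q : A) : lam (p * q) = 0 := by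
  by_contra hc
  have key := h (q + (-(lam (q * q) + 1) / (2 * lam (p * q))) • p)
  set t := -(lam (q * q) + 1) / (2 * lam (p * q)) with ht
  have h1 : (q + t • p) * (q + t • p) = q * q + (2 * t) • (p * q) + (t * t) • (p * p) := by
    simp only [Algebra.smul_def, map_mul, map_ofNat]
    ring
  have h2 : t * (2 * lam (p * q)) = -(lam (q * q) + 1) := by
    rw [ht]
    field_simp
  rw [h1, map_add, map_add, map_smul, map_smul, hp] at key
  simp only [smul_eq_mul] at key
  nlinarith

/-- The null ideal of a positive linear functional. -/
def nullIdeal (lam : A →ₗ[ℝ] ℝ) (h : ∀ p, 0 ≤ lam (p * p)) : Ideal A where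
  carrier := {p | lam (p * p) = 0}
  zero_mem' := by simp
  add_mem' := by
    intro p q hp hq
    have h1 := map_mul_eq_zero_of_map_mul_self h hp (p + (q + q))
    rw [mul_add, map_add, mul_add, map_add] at h1
    simp only [Set.mem_ofPred_eq] at *
    have h2 : (p + q) * (p + q) = p * p + p * q + p * q + q * q := by ring
    rw [h2, map_add, map_add, map_add]
    linarith
  smul_mem' := by
    intro c p hp
    have h1 := map_mul_eq_zero_of_map_mul_self h hp (c * c * p)
    simp only [Set.mem_ofPred_eq, smul_eq_mul] at *
    rw [← h1]
    congr 1
    ring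

lemma mem_nullIdeal {h : ∀ p, 0 ≤ lam (p * p)} {p : A} :
    p ∈ nullIdeal lam h ↔ lam (p * p) = 0 := Iff.rfl

lemma map_eq_zero_of_mem_nullIdeal {h : ∀ p, 0 ≤ lam (p * p)} {p : A}
    (hp : p ∈ nullIdeal lam h) : lam p = 0 := by
  simpa using map_mul_eq_zero_of_map_mul_self h hp 1

lemma map_nonneg_of_isSumSq (h : ∀ p, 0 ≤ lam (p * p)) {s : A} (hs : IsSumSq s) : 0 ≤ lam s := by
  induction hs with
  | zero => simp
  | sq_add a _ ih => rw [map_add]; exact add_nonneg (h a) ih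

lemma IsSumSq.exists_of_surjective {R S : Type*} [CommRing R] [CommRing S] {f : R →+* S}
    (hf : Function.Surjective f) {s : S} (hs : IsSumSq s) : ∃ t, IsSumSq t ∧ f t = s := by
  have := mem_sumSqOf_range f (x := s)
  rw [hf.range_eq, ← Set.range_id, ← RingHom.coe_id, mem_sumSqOf_range] at this
  exact this.1 ⟨s, hs, rfl⟩

lemma IsSumSq.exists_mul_sq_eq {D K : Type*} [CommRing D] [IsDomain D] [Field K] [Algebra D K]
    [IsFractionRing D K] {s : K} (hs : IsSumSq s) :
    ∃ b t : D, b ≠ 0 ∧ IsSumSq t ∧ s * (algebraMap D K b * algebraMap D K b) =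
      algebraMap D K t := by
  induction hs with
  | zero => exact ⟨1, 0, one_ne_zero, .zero, by simp⟩
  | sq_add a _ ih =>
    obtain ⟨b, t, hb, ht, hbt⟩ := ih
    obtain ⟨x, y, hy, rfl⟩ := IsFractionRing.div_surjective (A := D) a
    have hy0 : y ≠ 0 := nonZeroDivisors.ne_zero hy
    have hy0' : algebraMap D K y ≠ 0 := by simpa using hy0
    refine ⟨y * b, (x * b) * (x * b) + (y * y) * t, mul_ne_zero hy0 hb,
      .sq_add _ ((IsSumSq.mul_self y).mul ht), ?_⟩
    simp only [map_add, map_mul]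
    rw [← hbt]
    field_simp

lemma not_isSumSq_neg_one_fractionRing (h : ∀ p, 0 ≤ lam (p * p)) [(nullIdeal lam h).IsPrime] :
    ¬ IsSumSq (-1 : FractionRing (A ⧸ nullIdeal lam h)) := by
  intro hs
  obtain ⟨b, t, hb, ht, hbt⟩ := hs.exists_mul_sq_eq (D := A ⧸ nullIdeal lam h)
  obtain ⟨T, hT, rfl⟩ := ht.exists_of_surjective Ideal.Quotient.mk_surjective
  obtain ⟨B, rfl⟩ := Ideal.Quotient.mk_surjective b
  rw [← map_mul, ← map_mul, neg_one_mul, ← map_neg] at hbt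
  have h1 := IsFractionRing.injective (A ⧸ nullIdeal lam h) (FractionRing (A ⧸ nullIdeal lam h)) hbt
  have h2 : B * B + T ∈ nullIdeal lam h := by
    rw [← Ideal.Quotient.eq_zero_iff_mem, map_add, ← h1, add_neg_cancel]
  have h3 := map_eq_zero_of_mem_nullIdeal h2
  rw [map_add] at h3
  have h4 : lam (B * B) = 0 := by linarith [h B, map_nonneg_of_isSumSq h hT]
  exact hb (Ideal.Quotient.eq_zero_iff_mem.2 h4)

lemma exists_prime_nullIdeal [IsNoetherianRing A] (h : ∀ p, 0 ≤ lam (p * p)) {f : A}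
    (hf : f ∉ nullIdeal lam h) :
    ∃ (lam' : A →ₗ[ℝ] ℝ) (h' : ∀ p, 0 ≤ lam' (p * p)), (nullIdeal lam' h').IsPrime ∧
      nullIdeal lam h ≤ nullIdeal lam' h' ∧ f ∉ nullIdeal lam' h' := by
  let mu : A → A →ₗ[ℝ] ℝ := fun c => lam ∘ₗ LinearMap.mulLeft ℝ (c * c)
  have hmu : ∀ c p, mu c (p * p) = lam ((c * p) * (c * p)) := fun c p => by
    simp only [mu, LinearMap.comp_apply, LinearMap.mulLeft_apply]
    congr 1
    ring
  have hpos : ∀ c p, 0 ≤ mu c (p * p) := fun c p => hmu c p ▸ h _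
  have hmem : ∀ c p, p ∈ nullIdeal (mu c) (hpos c) ↔ c * p ∈ nullIdeal lam h := fun c p => by
    rw [mem_nullIdeal, mem_nullIdeal, hmu]
  obtain ⟨_, ⟨c, ⟨⟨e, rfl⟩, hc⟩, rfl⟩, hmax⟩ := set_has_maximal_iff_noetherian.2
    (inferInstanceAs (IsNoetherian A A))
    ((fun c => nullIdeal (mu c) (hpos c)) '' {c | f ∣ c ∧ c ∉ nullIdeal lam h})
    ⟨_, f, ⟨dvd_rfl, hf⟩, rfl⟩
  refine ⟨mu (f * e), hpos _, ⟨?_, ?_⟩, ?_, ?_⟩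
  · rw [Ideal.ne_top_iff_one, hmem, mul_one]
    exact hc
  · intro x y hxy
    by_contra! hn
    rw [hmem, hmem] at hn
    rw [hmem] at hxy
    refine hmax _ ⟨f * e * x, ⟨Dvd.intro _ (mul_assoc ..).symm, hn.1⟩, rfl⟩
      (lt_of_le_not_ge ?_ ?_)
    · intro p hp
      rw [hmem] at hp ⊢
      rw [mul_right_comm]
      exact Ideal.mul_mem_right _ _ hp
    · intro hle
      refine hn.2 ((hmem _ _).1 (hle ((hmem _ _).2 ?_)))
      rwa [mul_assoc]
  · intro p hp
    rw [hmem]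
    exact Ideal.mul_mem_left _ _ hp
  · rw [hmem]
    intro hfe
    refine hc (map_eq_zero_of_mem_nullIdeal (h := h) (?_ : f * e * (f * e) ∈ _))
    rw [← mul_assoc]
    exact Ideal.mul_mem_right _ _ hfe

end NullIdeal

lemma exists_separating_point {σ : Type} [Finite σ] {lam : MvPolynomial σ ℝ →ₗ[ℝ] ℝ}
    (h : ∀ p, 0 ≤ lam (p * p)) {f : MvPolynomial σ ℝ} (hf : f ∉ nullIdeal lam h) :
    ∃ a : σ → ℝ, (∀ p ∈ nullIdeal lam h, MvPolynomial.eval a p = 0) ∧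
      MvPolynomial.eval a f ≠ 0 := by
  obtain ⟨mu, hmu, hprime, hle, hfmu⟩ := exists_prime_nullIdeal h hf
  obtain ⟨L, _, _, hL⟩ := exists_polyIVT_extension (not_isSumSq_neg_one_fractionRing hmu)
  let D := MvPolynomial σ ℝ ⧸ nullIdeal mu hmu
  let π : D →+* L := (algebraMap (FractionRing D) L).comp (algebraMap D (FractionRing D))
  have hπ : Function.Injective π :=
    (algebraMap (FractionRing D) L).injective.comp (IsFractionRing.injective D _)
  let φ : MvPolynomial σ ℝ →+* L := π.comp (Ideal.Quotient.mk _)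
  have hφ : ∀ p, φ p = 0 ↔ p ∈ nullIdeal mu hmu := fun p => by
    rw [← Ideal.Quotient.eq_zero_iff_mem]
    exact map_eq_zero_iff π hπ
  have heval : ∀ p, p.eval₂ (φ.comp MvPolynomial.C) (φ ∘ MvPolynomial.X) = φ p := fun p => by
    rw [← MvPolynomial.eval₂_comp_left, MvPolynomial.eval₂_eta]
  obtain ⟨S, hS⟩ := (isNoetherianRing_iff_ideal_fg _).1 inferInstance (nullIdeal lam h)
  obtain ⟨a, hga, hfa⟩ := reflectsRealPoints hL (φ.comp MvPolynomial.C) (∑ q ∈ S, q * q) f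
    (φ ∘ MvPolynomial.X)
    (by
      rw [heval, map_sum]
      refine Finset.sum_eq_zero fun q hq => ?_
      rw [map_mul, (hφ q).2 (hle (hS ▸ Ideal.subset_span hq)), mul_zero])
    (by rw [heval]; exact fun h0 => hfmu ((hφ f).1 h0))
  rw [map_sum, Finset.sum_eq_zero_iff_of_nonneg
    (fun q _ => by rw [map_mul]; exact mul_self_nonneg _)] at hga
  refine ⟨a, ?_, hfa⟩
  have : nullIdeal lam h ≤ RingHom.ker (MvPolynomial.eval a) := by
    rw [← hS, Ideal.span_le]
    intro q hq
    have := hga q hq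
    rw [map_mul] at this
    exact mul_self_eq_zero.1 this
  exact fun p hp => this hp

end PositiveFunctional

section RealParts

open MvPolynomial

variable {n : ℕ}

/-- The inclusion of the real polynomials in the complex ones. -/
noncomputable def complexify (n : ℕ) : MvPolynomial (Fin n) ℝ →+* MvPolynomial (Fin n) ℂ :=
  MvPolynomial.map Complex.ofRealHom

lemma exists_eq_complexify_add (P : MvPolynomial (Fin n) ℂ) :
    ∃ A B, P = complexify n A + C Complex.I * complexify n B := by
  induction P using MvPolynomial.induction_on with
  | C z =>
    refine ⟨C z.re, C z.im, ?_⟩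
    simp only [complexify, map_C, Complex.ofRealHom_eq_coe, ← map_mul, ← map_add]
    rw [mul_comm Complex.I, Complex.re_add_im]
  | add P Q hP hQ =>
    obtain ⟨A, B, rfl⟩ := hP
    obtain ⟨A', B', rfl⟩ := hQ
    exact ⟨A + A', B + B', by simp only [map_add]; ring⟩
  | mul_X P i hP =>
    obtain ⟨A, B, rfl⟩ := hP
    have hX : complexify n (X i) = X i := map_X _ i
    exact ⟨A * X i, B * X i, by simp only [map_mul, hX]; ring⟩

lemma starC_complexify (A : MvPolynomial (Fin n) ℝ) :
    starC (complexify n A) = complexify n A := by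
  rw [starC, complexify, MvPolynomial.map_map]
  congr 2
  exact RingHom.ext Complex.conj_ofReal

lemma C_I_mul_self : (C Complex.I * C Complex.I : MvPolynomial (Fin n) ℂ) = -1 := by
  rw [← map_mul, Complex.I_mul_I, map_neg, map_one]

lemma starC_mul_self (A B : MvPolynomial (Fin n) ℝ) :
    starC (complexify n A + C Complex.I * complexify n B) *
      (complexify n A + C Complex.I * complexify n B) = complexify n (A * A + B * B) := by
  have h1 : starC (complexify n A + C Complex.I * complexify n B) =
      complexify n A - C Complex.I * complexify n B := by
    have hA := starC_complexify A
    have hB := starC_complexify B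
    simp only [starC, map_add, map_mul, map_C, Complex.conj_I, map_neg] at *
    rw [hA, hB]
    ring
  rw [h1]
  simp only [map_add, map_mul]
  linear_combination -(complexify n B * complexify n B) * C_I_mul_self (n := n)

lemma evalC_complexify (A : MvPolynomial (Fin n) ℝ) (x : Fin n → ℝ) :
    evalC (complexify n A) x = (eval x A : ℝ) := by
  rw [evalC, complexify, aeval_def, eval₂_map, Algebra.algebraMap_self, RingHom.id_comp]
  exact (eval₂_comp_left Complex.ofRealHom (RingHom.id ℝ) x A).symm

lemma evalC_eq_zero_iff (A B : MvPolynomial (Fin n) ℝ) (x : Fin n → ℝ) :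
    evalC (complexify n A + C Complex.I * complexify n B) x = 0 ↔
      eval x A = 0 ∧ eval x B = 0 := by
  have h1 : evalC (complexify n A + C Complex.I * complexify n B) x =
      evalC (complexify n A) x + Complex.I * evalC (complexify n B) x := by
    simp [evalC]
  rw [h1, evalC_complexify, evalC_complexify, Complex.ext_iff]
  simp

/-- The real part of a functional on complex polynomials, restricted to real polynomials. -/
noncomputable def reFunctional (Λ : MvPolynomial (Fin n) ℂ →ₗ[ℂ] ℂ) :
    MvPolynomial (Fin n) ℝ →ₗ[ℝ] ℝ where
  toFun A := (Λ (complexify n A)).re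
  map_add' A B := by simp
  map_smul' r A := by
    rw [MvPolynomial.smul_eq_C_mul, map_mul]
    have h1 : complexify n (C r) = C (r : ℂ) := map_C _ r
    rw [h1, ← MvPolynomial.smul_eq_C_mul, map_smul]
    simp

variable {Λ : MvPolynomial (Fin n) ℂ →ₗ[ℂ] ℂ}

lemma IsPosDefC.complexify_mul_self (hΛ : IsPosDefC Λ) (A : MvPolynomial (Fin n) ℝ) :
    0 ≤ Λ (complexify n (A * A)) := by
  have := hΛ (complexify n A)
  rwa [starC_complexify, ← map_mul] at this

lemma IsPosDefC.im_complexify (hΛ : IsPosDefC Λ) (A : MvPolynomial (Fin n) ℝ) :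
    (Λ (complexify n A)).im = 0 := by
  have h1 := (Complex.le_def.1 (hΛ.complexify_mul_self (A + 1))).2
  have h2 := (Complex.le_def.1 (hΛ.complexify_mul_self (A - 1))).2
  have h3 : (A + 1) * (A + 1) = (A - 1) * (A - 1) + A + A + A + A := by ring
  rw [h3] at h1
  simp only [map_add, Complex.add_im] at h1
  rw [← h2, Complex.zero_im] at h1
  linarith

lemma IsPosDefC.apply_complexify (hΛ : IsPosDefC Λ) (A : MvPolynomial (Fin n) ℝ) :
    Λ (complexify n A) = (reFunctional Λ A : ℝ) :=
  Complex.ext rfl (hΛ.im_complexify A)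

lemma IsPosDefC.reFunctional_nonneg (hΛ : IsPosDefC Λ) (A : MvPolynomial (Fin n) ℝ) :
    0 ≤ reFunctional Λ (A * A) :=
  (Complex.le_def.1 (hΛ.complexify_mul_self A)).1

lemma IsPosDefC.mem_nSetC_iff (hΛ : IsPosDefC Λ) (A B : MvPolynomial (Fin n) ℝ) :
    complexify n A + C Complex.I * complexify n B ∈ nSetC Λ ↔
      A ∈ nullIdeal (reFunctional Λ) hΛ.reFunctional_nonneg ∧
        B ∈ nullIdeal (reFunctional Λ) hΛ.reFunctional_nonneg := by
  change Λ _ = 0 ↔ _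
  rw [starC_mul_self, hΛ.apply_complexify, Complex.ofReal_eq_zero, map_add, mem_nullIdeal,
    mem_nullIdeal]
  exact add_eq_zero_iff_of_nonneg (hΛ.reFunctional_nonneg A) (hΛ.reFunctional_nonneg B)

end RealParts

theorem stmt_13 (n : ℕ) (hn : 0 < n)
    (Λ : MvPolynomial (Fin n) ℂ →ₗ[ℂ] ℂ) (hΛ : IsPosDefC Λ) :
    (∃ Z : Set (Fin n → ℝ),
      nSetC Λ = (vanishingIdealC Z : Set (MvPolynomial (Fin n) ℂ))) ∧
    nSetC Λ ⊆ {P | Λ P = 0} ∧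
    (∀ J : Ideal (MvPolynomial (Fin n) ℂ),
      (J : Set (MvPolynomial (Fin n) ℂ)) ⊆ {P | Λ P = 0} →
      (J : Set (MvPolynomial (Fin n) ℂ)) ⊆ nSetC Λ) := by
  refine ⟨⟨{x | ∀ p ∈ nullIdeal (reFunctional Λ) hΛ.reFunctional_nonneg,
    MvPolynomial.eval x p = 0}, ?_⟩, ?_, ?_⟩
  · ext P
    obtain ⟨A, B, rfl⟩ := exists_eq_complexify_add P
    rw [hΛ.mem_nSetC_iff]
    change _ ↔ ∀ x, (∀ p ∈ nullIdeal (reFunctional Λ) hΛ.reFunctional_nonneg,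
      MvPolynomial.eval x p = 0) → evalC _ x = 0
    simp only [evalC_eq_zero_iff]
    refine ⟨fun h x hx => ⟨hx A h.1, hx B h.2⟩, fun h => ⟨?_, ?_⟩⟩
    · by_contra hA
      obtain ⟨a, ha, hne⟩ := exists_separating_point hΛ.reFunctional_nonneg hA
      exact hne (h a ha).1
    · by_contra hB
      obtain ⟨a, ha, hne⟩ := exists_separating_point hΛ.reFunctional_nonneg hB
      exact hne (h a ha).2
  · intro P hP
    obtain ⟨A, B, rfl⟩ := exists_eq_complexify_add P
    rw [hΛ.mem_nSetC_iff] at hP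
    change Λ _ = 0
    rw [map_add, ← MvPolynomial.smul_eq_C_mul, map_smul, hΛ.apply_complexify,
      hΛ.apply_complexify, map_eq_zero_of_mem_nullIdeal hP.1, map_eq_zero_of_mem_nullIdeal hP.2]
    simp
  · exact fun J hJ P hP => hJ (J.mul_mem_left (starC P) hP)
end
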